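/- arXiv:1411.0995 — 2 statements merged into one kernel-verified Lean document; each statement's English description precedes it below -/
import Mathlib

section
/- Let a, a′ ∈ ℂ be nonzero and let b, b′ ∈ ℝ be nonzero. Then the Beloshapka models M(a,b) and M(a′,b′) are biholomorphically equivalent if and only if a·conj(a)/b² = a′·conj(a′)/b′². -/
open ComplexConjugate

noncomputable section

/-- The five-dimensional complex space `ℂ⁵` with coordinates `(z, w₁, w₂, w₃, w₄)`. -/
abbrev C5 : Type := ℂ × ℂ × ℂ × ℂ × ℂ

/-- Beloshapka's model `M(a,b) ⊆ ℂ⁵`, defined by the four real equations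
`Im w₁ = |z|²`, `Im w₂ = 2 Re(z² z̄)`, `Im w₃ = 2 Im(z² z̄)`,
`Im w₄ = 2 Re(a z³ z̄) + b |z|⁴`. -/
def BModel (a : ℂ) (b : ℝ) : Set C5 :=
  {p | p.2.1.im = Complex.normSq p.1 ∧
       p.2.2.1.im = 2 * (p.1 ^ 2 * conj p.1).re ∧
       p.2.2.2.1.im = 2 * (p.1 ^ 2 * conj p.1).im ∧
       p.2.2.2.2.im = 2 * (a * p.1 ^ 3 * conj p.1).re + b * Complex.normSq p.1 ^ 2}

/-- Two models are biholomorphically equivalent: there are open neighborhoods `U`, `V`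
of the origin and a holomorphic bijection `Φ : U → V` with holomorphic inverse `Ψ`,
`Φ(0) = 0`, mapping `M(a,b) ∩ U` onto `M(a',b') ∩ V`. -/
def BiholEquiv (a : ℂ) (b : ℝ) (a' : ℂ) (b' : ℝ) : Prop :=
  ∃ (U V : Set C5) (Φ Ψ : C5 → C5),
    IsOpen U ∧ IsOpen V ∧ (0 : C5) ∈ U ∧ (0 : C5) ∈ V ∧
    DifferentiableOn ℂ Φ U ∧ DifferentiableOn ℂ Ψ V ∧
    Φ 0 = 0 ∧ Set.MapsTo Φ U V ∧ Set.MapsTo Ψ V U ∧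
    (∀ p ∈ U, Ψ (Φ p) = p) ∧ (∀ q ∈ V, Φ (Ψ q) = q) ∧
    Φ '' (BModel a b ∩ U) = BModel a' b' ∩ V

/-- Algebraic core of the necessity direction. -/
lemma alg_core (a a' l : ℂ) (b b' : ℝ) (α β γ δ ε κ : ℂ)
    (h : ∀ y ∈ BModel a b,
      (α * y.1 ^ 4 + β * (y.1 ^ 2 * y.2.1) + γ * y.2.1 ^ 2 + δ * (y.1 * y.2.2.1)
        + ε * (y.1 * y.2.2.2.1) + κ * y.2.2.2.2).im =
      2 * (a' * (l * y.1) ^ 3 * conj (l * y.1)).re + b' * Complex.normSq (l * y.1) ^ 2) :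
    κ.im = 0 ∧ κ.re * a.re = (a' * l ^ 3 * conj l).re ∧ κ.re * a.im = (a' * l ^ 3 * conj l).im
      ∧ κ.re * b = b' * Complex.normSq l ^ 2 := by
  obtain ⟨A, hA⟩ : ∃ A, A = a' * l ^ 3 * conj l := ⟨_, rfl⟩
  obtain ⟨B, hB⟩ : ∃ B, B = b' * Complex.normSq l ^ 2 := ⟨_, rfl⟩
  have key : ∀ (z : ℂ) (u1 u2 u3 u4 : ℝ),
      (α * z ^ 4 + β * (z ^ 2 * (⟨u1, Complex.normSq z⟩ : ℂ)) + γ * (⟨u1, Complex.normSq z⟩ : ℂ) ^ 2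
        + δ * (z * (⟨u2, 2 * (z ^ 2 * conj z).re⟩ : ℂ))
        + ε * (z * (⟨u3, 2 * (z ^ 2 * conj z).im⟩ : ℂ))
        + κ * (⟨u4, 2 * (a * z ^ 3 * conj z).re + b * Complex.normSq z ^ 2⟩ : ℂ)).im =
      2 * (A * z ^ 3 * conj z).re + B * Complex.normSq z ^ 2 := by
    intro z u1 u2 u3 u4
    have := h (z, ⟨u1, Complex.normSq z⟩, ⟨u2, 2 * (z ^ 2 * conj z).re⟩,
      ⟨u3, 2 * (z ^ 2 * conj z).im⟩, ⟨u4, 2 * (a * z ^ 3 * conj z).re + b * Complex.normSq z ^ 2⟩)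
      ⟨rfl, rfl, rfl, rfl⟩
    dsimp only at this
    rw [this, hA, hB, Complex.normSq_mul, map_mul]
    congr 1
    · congr 2; ring
    · ring
  rw [← hA, ← hB]
  clear hA hB h
  have h1 := key 0 0 0 0 1
  have h2 := key 0 1 0 0 0
  have k0 := key 1 0 0 0 0
  have k1 := key 1 1 0 0 0
  have k2 := key 1 0 1 0 0
  have k3 := key 1 0 0 1 0
  have i0 := key ⟨0, 1⟩ 0 0 0 0
  have i1 := key ⟨0, 1⟩ 1 0 0 0
  have i2 := key ⟨0, 1⟩ 0 1 0 0
  have i3 := key ⟨0, 1⟩ 0 0 1 0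
  have p0 := key ⟨1, 1⟩ 0 0 0 0
  have p1 := key ⟨1, 1⟩ 1 0 0 0
  have m0 := key ⟨1, -1⟩ 0 0 0 0
  simp [Complex.normSq_apply, pow_succ] at h1 h2 k0 k1 k2 k3 i0 i1 i2 i3 p0 p1 m0
  have e1 : γ.re = 0 := by linarith
  have e2 : β.im = 0 := by linarith
  have e3 : β.re = 0 := by linarith
  have e4 : δ.im = 0 := by linarith
  have e5 : δ.re = 0 := by linarith
  have e6 : ε.im = 0 := by linarith
  have e7 : ε.re = 0 := by linarith
  simp only [h2, e2, e3, e4, e5, e6, e7] at k0 i0 p0 m0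
  refine ⟨h1, ?_, ?_, ?_⟩ <;> linarith

lemma modulus_core (a a' l : ℂ) (b b' : ℝ) (hb : b ≠ 0) (hb' : b' ≠ 0) (hl : l ≠ 0) (k : ℝ)
    (h1 : k * a.re = (a' * l ^ 3 * conj l).re) (h2 : k * a.im = (a' * l ^ 3 * conj l).im)
    (h3 : k * b = b' * Complex.normSq l ^ 2) :
    a * conj a / (b : ℂ) ^ 2 = a' * conj a' / (b' : ℂ) ^ 2 := by
  have hA : (k : ℂ) * a = a' * l ^ 3 * conj l := by
    apply Complex.ext
    · simpa using h1
    · simpa using h2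
  have hn : Complex.normSq l ≠ 0 := by simpa using hl
  have hk : k ≠ 0 := by
    rintro rfl
    have : b' * Complex.normSq l ^ 2 ≠ 0 := by positivity
    apply this; rw [← h3]; simp
  have hN := congrArg Complex.normSq hA
  simp only [Complex.normSq_mul, map_pow, Complex.normSq_conj, Complex.normSq_ofReal] at hN
  rw [Complex.mul_conj, Complex.mul_conj]
  norm_cast
  rw [div_eq_div_iff (by positivity) (by positivity)]
  have : (k * k) * (Complex.normSq a * b' ^ 2) = (k * k) * (Complex.normSq a' * b ^ 2) := by
    calc (k * k) * (Complex.normSq a * b' ^ 2) = (k * k * Complex.normSq a) * b' ^ 2 := by ring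
      _ = Complex.normSq a' * (b' * Complex.normSq l ^ 2) ^ 2 := by rw [hN]; ring
      _ = _ := by rw [← h3]; ring
  exact mul_left_cancel₀ (by positivity) this

lemma suff_dir (a a' : ℂ) (b b' : ℝ)
    (ha : a ≠ 0) (ha' : a' ≠ 0) (hb : b ≠ 0) (hb' : b' ≠ 0)
    (h : a * conj a / (b : ℂ) ^ 2 = a' * conj a' / (b' : ℂ) ^ 2) : BiholEquiv a b a' b' := by
  obtain ⟨r, hr⟩ : ∃ r : ℝ, r = b' / b := ⟨_, rfl⟩
  have hr0 : r ≠ 0 := by rw [hr]; positivity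
  obtain ⟨l, hl⟩ := IsAlgClosed.exists_pow_nat_eq ((r : ℂ) * a / a') (n := 2) (by norm_num)
  have hn0 : Complex.normSq a * b' ^ 2 = Complex.normSq a' * b ^ 2 := by
    rw [Complex.mul_conj, Complex.mul_conj] at h
    norm_cast at h
    rwa [div_eq_div_iff (by positivity) (by positivity)] at h
  have hna' : Complex.normSq a' ≠ 0 := by simpa using ha'
  have hl1 : Complex.normSq l = 1 := by
    have h1 := congrArg Complex.normSq hl
    simp only [map_pow, Complex.normSq_div, Complex.normSq_mul, Complex.normSq_ofReal] at h1
    have h2 : r * r * Complex.normSq a / Complex.normSq a' = 1 := by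
      rw [hr]; field_simp; linarith
    rw [h2] at h1
    have h3 := Complex.normSq_nonneg l
    nlinarith
  have hll : l * conj l = 1 := by rw [Complex.mul_conj, hl1]; simp
  have hll' : conj l * l = 1 := by rw [mul_comm, hll]
  have hla : a' * l ^ 2 = r * a := by rw [hl]; field_simp
  have hrb : b' = r * b := by rw [hr]; field_simp
  have hre : (l.re : ℂ) * l.re + l.im * l.im = 1 := by
    rw [Complex.normSq_apply] at hl1; exact_mod_cast hl1
  have hrc : (r : ℂ) ≠ 0 := by exact_mod_cast hr0
  have hz : ∀ z : ℂ, (l * z) ^ 2 * conj (l * z) = l * (z ^ 2 * conj z) := by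
    intro z
    rw [map_mul]
    linear_combination (l * z ^ 2 * conj z) * hll
  have hq : ∀ z : ℂ, a' * (l * z) ^ 3 * conj (l * z) = r * (a * z ^ 3 * conj z) := by
    intro z
    rw [map_mul]
    linear_combination (a' * l ^ 2 * z ^ 3 * conj z) * hll + (z ^ 3 * conj z) * hla
  let Φ : C5 → C5 := fun p => (l * p.1, p.2.1, l.re * p.2.2.1 - l.im * p.2.2.2.1,
    l.im * p.2.2.1 + l.re * p.2.2.2.1, r * p.2.2.2.2)
  let Ψ : C5 → C5 := fun p => (conj l * p.1, p.2.1, l.re * p.2.2.1 + l.im * p.2.2.2.1,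
    -l.im * p.2.2.1 + l.re * p.2.2.2.1, (r : ℂ)⁻¹ * p.2.2.2.2)
  have hΨΦ : ∀ p, Ψ (Φ p) = p := by
    rintro ⟨z, w1, w2, w3, w4⟩
    simp only [Φ, Ψ, Prod.mk.injEq, true_and]
    refine ⟨?_, ?_, ?_, ?_⟩
    · linear_combination z * hll
    · linear_combination w2 * hre
    · linear_combination w3 * hre
    · field_simp
  have hΦΨ : ∀ p, Φ (Ψ p) = p := by
    rintro ⟨z, w1, w2, w3, w4⟩
    simp only [Φ, Ψ, Prod.mk.injEq, true_and]
    refine ⟨?_, ?_, ?_, ?_⟩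
    · linear_combination z * hll
    · linear_combination w2 * hre
    · linear_combination w3 * hre
    · field_simp
  have hiff : ∀ p, Φ p ∈ BModel a' b' ↔ p ∈ BModel a b := by
    rintro ⟨z, w1, w2, w3, w4⟩
    simp only [BModel, Set.mem_setOf_eq, Φ, hz, hq, Complex.normSq_mul, hl1, one_mul]
    have e1 : ((l.re : ℂ) * w2 - l.im * w3).im = l.re * w2.im - l.im * w3.im := by simp
    have e2 : ((l.im : ℂ) * w2 + l.re * w3).im = l.im * w2.im + l.re * w3.im := by simp
    have e3 : ((r : ℂ) * w4).im = r * w4.im := by simp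
    have e4 : ((r : ℂ) * (a * z ^ 3 * conj z)).re = r * (a * z ^ 3 * conj z).re := by simp
    rw [e1, e2, e3, e4, hrb]
    generalize z ^ 2 * conj z = m
    rw [Complex.mul_re, Complex.mul_im]
    have hreR : l.re * l.re + l.im * l.im = 1 := by rw [← Complex.normSq_apply, hl1]
    constructor
    · rintro ⟨h1, h2, h3, h4⟩
      refine ⟨h1, ?_, ?_, ?_⟩
      · linear_combination l.re * h2 + l.im * h3 - (w2.im - 2 * m.re) * hreR
      · linear_combination -l.im * h2 + l.re * h3 - (w3.im - 2 * m.im) * hreR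
      · apply mul_left_cancel₀ hr0
        linear_combination h4
    · rintro ⟨h1, h2, h3, h4⟩
      refine ⟨h1, ?_, ?_, ?_⟩
      · linear_combination l.re * h2 - l.im * h3
      · linear_combination l.im * h2 + l.re * h3
      · linear_combination r * h4
  refine ⟨Set.univ, Set.univ, Φ, Ψ, isOpen_univ, isOpen_univ, trivial, trivial, ?_, ?_, ?_,
    fun _ _ => trivial, fun _ _ => trivial, fun p _ => hΨΦ p, fun p _ => hΦΨ p, ?_⟩
  · apply Differentiable.differentiableOn
    simp only [Φ]; fun_prop
  · apply Differentiable.differentiableOn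
    simp only [Ψ]; fun_prop
  · simp [Φ]
  · simp only [Set.inter_univ]
    ext q
    constructor
    · rintro ⟨p, hp, rfl⟩
      exact (hiff p).2 hp
    · intro hq
      refine ⟨Ψ q, ?_, hΦΨ q⟩
      rw [← hiff, hΦΨ]; exact hq

open Metric Set Filter Topology MeasureTheory

lemma differentiableOn_clm_of_apply {F : Type} [NormedAddCommGroup F] [NormedSpace ℂ F]
    {f : C5 → C5 →L[ℂ] F} {s : Set C5}
    (h : ∀ v, DifferentiableOn ℂ (fun x => f x v) s) : DifferentiableOn ℂ f s := by
  let d := Module.finrank ℂ C5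
  have hd : d = Module.finrank ℂ (Fin d → ℂ) := (Module.finrank_fin_fun ℂ).symm
  let e₁ := ContinuousLinearEquiv.ofFinrankEq hd
  let e₂ := (e₁.arrowCongr (1 : F ≃L[ℂ] F)).trans (ContinuousLinearEquiv.piRing (Fin d))
  rw [← Function.id_comp f, ← e₂.symm_comp_self]
  exact e₂.symm.differentiable.comp_differentiableOn
    (differentiableOn_pi.mpr fun i => h _)

/-- The derivative of a bounded holomorphic function is bounded. -/
lemma fderiv_bound {F : Type} [NormedAddCommGroup F] [NormedSpace ℂ F]
    {G : C5 → F} {x₀ : C5} {R M : ℝ} (hR : 0 < R)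
    (hd : DifferentiableOn ℂ G (ball x₀ (3 * R)))
    (hM : ∀ x ∈ ball x₀ (3 * R), ‖G x‖ ≤ M) {x : C5} (hx : x ∈ ball x₀ (2 * R)) :
    ‖fderiv ℂ G x‖ ≤ (2 * M) / R := by
  have hsub : ball x R ⊆ ball x₀ (3 * R) := by
    apply ball_subset_ball'
    have := mem_ball.1 hx
    linarith
  apply Complex.norm_fderiv_le_div_of_mapsTo_ball (hd.mono hsub) _ hR
  intro y hy
  rw [mem_closedBall, dist_eq_norm]
  calc _ ≤ ‖G y‖ + ‖G x‖ := norm_sub_le _ _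
    _ ≤ M + M := add_le_add (hM _ (hsub hy)) (hM _ (hsub (mem_ball_self hR)))
    _ = _ := by ring

lemma differentiableOn_fderiv {F : Type} [NormedAddCommGroup F] [NormedSpace ℂ F]
    [FiniteDimensional ℂ F] {G : C5 → F} {U : Set C5} (hU : IsOpen U)
    (hG : DifferentiableOn ℂ G U) : DifferentiableOn ℂ (fderiv ℂ G) U := by
  have : CompleteSpace F := FiniteDimensional.complete ℂ F
  have : FiniteDimensional ℂ (C5 →L[ℂ] F) := inferInstance
  have : ProperSpace (C5 →L[ℂ] F) := FiniteDimensional.proper ℂ _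
  have : SecondCountableTopology (C5 →L[ℂ] F) := inferInstance
  apply differentiableOn_clm_of_apply
  intro v x₀ hx₀
  apply DifferentiableAt.differentiableWithinAt
  -- choose a ball on which everything is bounded
  obtain ⟨R, hR, M, hsub, hM⟩ : ∃ R > 0, ∃ M : ℝ, ball x₀ (3 * R) ⊆ U ∧
      ∀ x ∈ ball x₀ (3 * R), ‖G x‖ ≤ M := by
    have hc : ContinuousAt G x₀ := hG.continuousOn.continuousAt (hU.mem_nhds hx₀)
    have h1 : ∀ᶠ x in 𝓝 x₀, ‖G x‖ < ‖G x₀‖ + 1 :=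
      hc.norm.eventually_lt continuousAt_const (by simp)
    obtain ⟨r, hr, h⟩ := Metric.eventually_nhds_iff_ball.1 (h1.and (hU.mem_nhds hx₀))
    refine ⟨r / 3, by positivity, ‖G x₀‖ + 1, ?_, ?_⟩
    · intro x hx; exact (h x (by convert hx using 2; ring)).2
    · intro x hx; exact (h x (by convert hx using 2; ring)).1.le
  have hGB := hG.mono hsub
  obtain ⟨ρ, hρ, hρv⟩ : ∃ ρ > 0, ρ * ‖v‖ < R := by
    refine ⟨R / (‖v‖ + 1), by positivity, ?_⟩
    rw [div_mul_eq_mul_div, div_lt_iff₀ (by positivity)]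
    nlinarith [norm_nonneg v]
  have hmem : ∀ x ∈ ball x₀ R, ∀ s : ℂ, ‖s‖ ≤ ρ → x + s • v ∈ ball x₀ (2 * R) := by
    intro x hx s hs
    rw [mem_ball, dist_eq_norm] at *
    calc ‖x + s • v - x₀‖ = ‖(x - x₀) + s • v‖ := by congr 1; abel
      _ ≤ ‖x - x₀‖ + ‖s‖ * ‖v‖ := (norm_add_le _ _).trans (by rw [norm_smul])
      _ ≤ ‖x - x₀‖ + ρ * ‖v‖ := by gcongr
      _ < 2 * R := by linarith
  have h23 : ball x₀ (2 * R) ⊆ ball x₀ (3 * R) := ball_subset_ball (by linarith)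
  have hda : ∀ x ∈ ball x₀ (2 * R), DifferentiableAt ℂ G x := fun x hx =>
    hGB.differentiableAt (isOpen_ball.mem_nhds (h23 hx))
  have hformula : ∀ x ∈ ball x₀ R, fderiv ℂ G x v =
      (2 * Real.pi * Complex.I : ℂ)⁻¹ • ∮ s in C(0, ρ), ((s - 0) ^ 2)⁻¹ • G (x + s • v) := by
    intro x hx
    have hO : IsOpen ((fun s : ℂ => x + s • v) ⁻¹' (ball x₀ (2 * R))) :=
      isOpen_ball.preimage (by fun_prop)
    rw [Complex.two_pi_I_inv_smul_circleIntegral_sub_sq_inv_smul_of_differentiable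
      (f := fun s : ℂ => G (x + s • v)) hO (c := 0) (R := ρ) (w₀ := 0)]
    · have h0 : HasDerivAt (fun s : ℂ => x + s • v) v 0 := by
        simpa using ((hasDerivAt_id (0 : ℂ)).smul_const v).const_add x
      have hx2 : x + (0 : ℂ) • v ∈ ball x₀ (2 * R) := hmem x hx 0 (by simpa using hρ.le)
      have := (hda _ hx2).hasFDerivAt.comp_hasDerivAt (0 : ℂ) h0
      have := this.deriv
      simp only [Function.comp_def] at this
      rw [this]; simp
    · intro s hs
      exact hmem x hx s (by simpa using hs)
    · intro s hs
      have h0 : DifferentiableAt ℂ (fun s : ℂ => x + s • v) s := by fun_prop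
      exact ((hda _ hs).comp s h0).differentiableWithinAt
    · simpa using hρ
  have hev : (fun x => fderiv ℂ G x v) =ᶠ[𝓝 x₀] fun x =>
      (2 * Real.pi * Complex.I : ℂ)⁻¹ • ∮ s in C(0, ρ), ((s - 0) ^ 2)⁻¹ • G (x + s • v) := by
    filter_upwards [ball_mem_nhds x₀ hR] with x hx using hformula x hx
  refine DifferentiableAt.congr_of_eventuallyEq ?_ hev
  apply DifferentiableAt.const_smul
  simp only [circleIntegral]
  let c : ℝ → ℂ := fun θ => deriv (circleMap 0 ρ) θ * ((circleMap 0 ρ θ - 0) ^ 2)⁻¹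
  have hcm : ∀ θ, ‖circleMap 0 ρ θ‖ = ρ := fun θ => by simp [abs_of_pos hρ]
  have hcc : Continuous c := by
    simp only [c, deriv_circleMap]
    refine Continuous.mul (by fun_prop) (Continuous.inv₀ (by fun_prop) ?_)
    intro θ h
    have := hcm θ
    have h0 : circleMap 0 ρ θ = 0 := by simpa using h
    rw [h0] at this; simp at this; linarith
  have hc0 : ∀ θ, ‖c θ‖ = ρ⁻¹ := by
    intro θ
    simp only [c, deriv_circleMap, norm_mul, norm_inv, norm_pow, sub_zero, hcm, Complex.norm_I]
    field_simp
  have hcont : ∀ x ∈ ball x₀ R, 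
      Continuous fun θ : ℝ => c θ • G (x + circleMap 0 ρ θ • v) := by
    intro x hx
    refine hcc.smul ?_
    refine ContinuousOn.comp_continuous (s := ball x₀ (3 * R)) hGB.continuousOn (by fun_prop) ?_
    intro θ
    exact h23 (hmem x hx _ (hcm θ).le)
  have main := intervalIntegral.hasFDerivAt_integral_of_dominated_of_fderiv_le
    (𝕜 := ℂ) (μ := volume) (a := 0) (b := 2 * Real.pi) (s := ball x₀ R)
    (F := fun (x : C5) (θ : ℝ) => c θ • G (x + circleMap 0 ρ θ • v))
    (F' := fun (x : C5) (θ : ℝ) => c θ • fderiv ℂ G (x + circleMap 0 ρ θ • v))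
    (x₀ := x₀) (bound := fun _ => ρ⁻¹ * ((2 * M) / R)) (ball_mem_nhds x₀ hR)
    ?_ ?_ ?_ ?_ ?_ ?_
  · refine main.differentiableAt.congr_of_eventuallyEq (Eventually.of_forall fun x => ?_)
    simp only [c, smul_smul]
  · filter_upwards [ball_mem_nhds x₀ hR] with x hx
    exact (hcont x hx).aestronglyMeasurable
  · exact (hcont x₀ (mem_ball_self hR)).intervalIntegrable _ _
  · refine AEStronglyMeasurable.smul hcc.aestronglyMeasurable ?_
    have hm : Measurable (fderiv ℂ G) := measurable_fderiv ℂ G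
    have : Measurable fun θ : ℝ => fderiv ℂ G (x₀ + circleMap 0 ρ θ • v) :=
      hm.comp (Continuous.measurable (by fun_prop))
    exact this.aestronglyMeasurable
  · refine Eventually.of_forall fun θ _ x hx => ?_
    rw [norm_smul, hc0]
    gcongr
    exact fderiv_bound hR hGB hM (hmem x hx _ (hcm θ).le)
  · exact intervalIntegrable_const
  · refine Eventually.of_forall fun θ _ x hx => ?_
    have h1 := (hda _ (hmem x hx _ (hcm θ).le)).hasFDerivAt
    have h2 : HasFDerivAt (fun x : C5 => x + circleMap 0 ρ θ • v) (ContinuousLinearMap.id ℂ C5) x :=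
      (hasFDerivAt_id x).add_const _
    have h3 := (h1.comp x h2).const_smul (c θ)
    rw [ContinuousLinearMap.comp_id] at h3
    exact h3
open Asymptotics

/-- Taylor expansion of a holomorphic function on `ℂ⁵` at the origin. -/
lemma taylor_C5 (n : ℕ) : ∀ {F : Type} [NormedAddCommGroup F] [NormedSpace ℂ F]
    [FiniteDimensional ℂ F] {G : C5 → F} {U : Set C5} (_ : IsOpen U) (_ : (0 : C5) ∈ U)
    (_ : DifferentiableOn ℂ G U),
    ∃ p : (k : ℕ) → ContinuousMultilinearMap ℂ (fun _ : Fin k => C5) F,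
      (fun x => G x - ∑ k ∈ Finset.range n, p k (fun _ => x)) =O[𝓝 0] fun x => ‖x‖ ^ n := by
  induction n with
  | zero =>
    intro F _ _ _ G U hU h0 hG
    refine ⟨fun _ => 0, ?_⟩
    have hc : ContinuousAt G 0 := hG.continuousOn.continuousAt (hU.mem_nhds h0)
    simpa using hc.isBigO_one ℝ
  | succ n ih =>
    intro F _ _ _ G U hU h0 hG
    have hfin : FiniteDimensional ℂ (C5 →L[ℂ] F) := inferInstance
    obtain ⟨q, hq⟩ := ih hU h0 (differentiableOn_fderiv hU hG)
    let p : (k : ℕ) → ContinuousMultilinearMap ℂ (fun _ : Fin k => C5) F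
      | 0 => (continuousMultilinearCurryFin0 ℂ C5 F).symm (G 0)
      | k + 1 => ((k + 1 : ℂ)⁻¹) • (continuousMultilinearCurryRightEquiv' ℂ k C5 F).symm (q k)
    have hp0 : ∀ x : C5, p 0 (fun _ => x) = G 0 := fun x => rfl
    have hps : ∀ (k : ℕ) (x : C5), p (k + 1) (fun _ => x) = ((k + 1 : ℂ)⁻¹) • (q k (fun _ => x) x) :=
      fun k x => rfl
    refine ⟨p, ?_⟩
    obtain ⟨C, hC0, hC⟩ := hq.exists_pos
    rw [isBigOWith_iff] at hC
    obtain ⟨r, hr, h⟩ := Metric.eventually_nhds_iff_ball.1 (hC.and (hU.mem_nhds h0))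
    refine IsBigO.of_bound C ?_
    filter_upwards [ball_mem_nhds (0 : C5) hr] with x hx
    have hsx : ∀ s ∈ Icc (0 : ℝ) 1, ((s : ℂ) • x) ∈ ball (0 : C5) r := by
      intro s hs
      rw [mem_ball_zero_iff] at *
      rw [norm_smul, Complex.norm_real, Real.norm_of_nonneg hs.1]
      nlinarith [hs.2, hs.1, norm_nonneg x]
    let f : ℝ → F := fun s => G ((s : ℂ) • x) -
      ∑ k ∈ Finset.range n, ((s : ℂ) ^ (k + 1)) • p (k + 1) (fun _ => x)
    let f' : ℝ → F := fun s => (fderiv ℂ G ((s : ℂ) • x) -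
      ∑ k ∈ Finset.range n, q k (fun _ => (s : ℂ) • x)) x
    have hder : ∀ s ∈ Icc (0 : ℝ) 1, HasDerivWithinAt f (f' s) (Icc (0 : ℝ) 1) s := by
      intro s hs
      apply HasDerivAt.hasDerivWithinAt
      have hG' : HasFDerivAt G (fderiv ℂ G ((s : ℂ) • x)) ((s : ℂ) • x) :=
        (hG.differentiableAt (hU.mem_nhds (h _ (hsx s hs)).2)).hasFDerivAt
      have h1 : HasDerivAt (fun z : ℂ => G (z • x)) (fderiv ℂ G ((s : ℂ) • x) x) (s : ℂ) := by
        have h0 : HasDerivAt (fun z : ℂ => z • x) x (s : ℂ) := by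
          simpa using (hasDerivAt_id (s : ℂ)).smul_const x
        exact hG'.comp_hasDerivAt (s : ℂ) h0
      have h2 : HasDerivAt (fun z : ℂ => ∑ k ∈ Finset.range n, (z ^ (k + 1)) • p (k + 1) (fun _ => x))
          (∑ k ∈ Finset.range n, q k (fun _ => (s : ℂ) • x) x) (s : ℂ) := by
        apply HasDerivAt.fun_sum
        intro k _
        have h3 := (hasDerivAt_pow (k + 1) (s : ℂ)).smul_const (p (k + 1) (fun _ => x))
        convert h3 using 1
        rw [hps, smul_smul]
        have hk : ((k : ℂ) + 1) ≠ 0 := by exact_mod_cast Nat.succ_ne_zero k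
        have h4 := (q k).map_smul_univ (fun _ => (s : ℂ)) (fun _ => x)
        rw [h4]
        simp only [Finset.prod_const, Finset.card_univ, Fintype.card_fin, smul_apply]
        congr 1
        push_cast
        field_simp
      have h6 : HasDerivAt (fun u : ℝ => (u : ℂ)) 1 s := Complex.ofRealCLM.hasDerivAt
      have h5 := HasDerivAt.scomp s (h1.sub h2) h6
      simpa [f, f', Function.comp_def] using h5
    have hb : ∀ s ∈ Ico (0 : ℝ) 1, ‖f' s‖ ≤ C * ‖x‖ ^ (n + 1) := by
      intro s hs
      have hs' : s ∈ Icc (0 : ℝ) 1 := ⟨hs.1, hs.2.le⟩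
      have h1 := (h _ (hsx s hs')).1
      have h2 : ‖(s : ℂ) • x‖ ≤ ‖x‖ := by
        rw [norm_smul, Complex.norm_real, Real.norm_of_nonneg hs.1]
        nlinarith [hs.2, hs.1, norm_nonneg x]
      calc ‖f' s‖ ≤ _ * ‖x‖ := ContinuousLinearMap.le_opNorm _ _
        _ ≤ (C * ‖‖(s : ℂ) • x‖ ^ n‖) * ‖x‖ := by gcongr
        _ ≤ (C * ‖x‖ ^ n) * ‖x‖ := by
          rw [norm_pow, norm_norm]; gcongr
        _ = _ := by ring
    have hfin := norm_image_sub_le_of_norm_deriv_le_segment_01' hder hb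
    rw [norm_pow, norm_norm]
    convert hfin using 2
    simp only [f, Finset.sum_range_succ' _ n, hp0]
    simp [sub_sub]

def wt : Fin 5 → ℕ := ![1, 2, 3, 3, 4]
def crd (x : C5) : Fin 5 → ℂ := ![x.1, x.2.1, x.2.2.1, x.2.2.2.1, x.2.2.2.2]
def bas : Fin 5 → C5 := ![(1, 0, 0, 0, 0), (0, 1, 0, 0, 0), (0, 0, 1, 0, 0), (0, 0, 0, 1, 0),
  (0, 0, 0, 0, 1)]

lemma crd_bas (x : C5) : x = ∑ i, crd x i • bas i := by
  obtain ⟨a, b, c, d, e⟩ := x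
  simp [Fin.sum_univ_five, crd, bas]

/-- Weighted dilation. -/
def scl (t : ℝ) (y : C5) : C5 :=
  (t * y.1, t ^ 2 * y.2.1, t ^ 3 * y.2.2.1, t ^ 3 * y.2.2.2.1, t ^ 4 * y.2.2.2.2)

lemma crd_scl (t : ℝ) (y : C5) (i : Fin 5) : crd (scl t y) i = (t : ℂ) ^ wt i * crd y i := by
  fin_cases i <;> simp [crd, scl, wt]

/-- Functions having a weighted expansion up to weight four. -/
def Good (F : C5 → ℂ) : Prop :=
  ∃ α β γ δ ε κ : ℂ, ∀ y : C5, ∃ q0 q1 q2 q3 : ℂ,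
    (fun t : ℝ => F (scl t y) - (q0 + t * q1 + t ^ 2 * q2 + t ^ 3 * q3 +
      t ^ 4 * (α * y.1 ^ 4 + β * (y.1 ^ 2 * y.2.1) + γ * y.2.1 ^ 2 + δ * (y.1 * y.2.2.1)
        + ε * (y.1 * y.2.2.2.1) + κ * y.2.2.2.2))) =O[𝓝 0] fun t : ℝ => t ^ 5

lemma Good.add {F G : C5 → ℂ} (hF : Good F) (hG : Good G) : Good (fun x => F x + G x) := by
  obtain ⟨α, β, γ, δ, ε, κ, h⟩ := hF
  obtain ⟨α', β', γ', δ', ε', κ', h'⟩ := hG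
  refine ⟨α + α', β + β', γ + γ', δ + δ', ε + ε', κ + κ', fun y => ?_⟩
  obtain ⟨q0, q1, q2, q3, hq⟩ := h y
  obtain ⟨q0', q1', q2', q3', hq'⟩ := h' y
  refine ⟨q0 + q0', q1 + q1', q2 + q2', q3 + q3', (hq.add hq').congr_left fun t => ?_⟩
  ring

lemma Good.mul_const {F : C5 → ℂ} (hF : Good F) (c : ℂ) : Good (fun x => F x * c) := by
  obtain ⟨α, β, γ, δ, ε, κ, h⟩ := hF
  refine ⟨c * α, c * β, c * γ, c * δ, c * ε, c * κ, fun y => ?_⟩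
  obtain ⟨q0, q1, q2, q3, hq⟩ := h y
  refine ⟨c * q0, c * q1, c * q2, c * q3, (hq.const_mul_left c).congr_left fun t => ?_⟩
  ring

lemma Good.zero : Good (fun _ => 0) := by
  refine ⟨0, 0, 0, 0, 0, 0, fun y => ⟨0, 0, 0, 0, ?_⟩⟩
  simpa using isBigO_zero _ _

lemma Good.sum {ι : Type} (s : Finset ι) {F : ι → C5 → ℂ} (h : ∀ i, Good (F i)) :
    Good (fun x => ∑ i ∈ s, F i x) := by
  classical
  induction s using Finset.induction_on with
  | empty => simpa using Good.zero
  | insert i s hi ih => simpa [Finset.sum_insert hi] using (h i).add ih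

lemma scl_isBigO (y : C5) : (fun t : ℝ => scl t y) =O[𝓝 0] fun t : ℝ => t := by
  have aux : ∀ (n : ℕ) (c : ℂ), (fun t : ℝ => (t : ℂ) ^ (n + 1) * c) =O[𝓝 0] fun t : ℝ => t := by
    intro n c
    refine IsBigO.of_bound ‖c‖ ?_
    filter_upwards [ball_mem_nhds (0 : ℝ) one_pos] with t ht
    rw [mem_ball_zero_iff] at ht
    rw [norm_mul, norm_pow, Complex.norm_real, mul_comm]
    gcongr
    rw [pow_succ]
    exact mul_le_of_le_one_left (norm_nonneg _) (pow_le_one₀ (norm_nonneg _) ht.le)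
  unfold scl
  refine IsBigO.prod_left ?_ (IsBigO.prod_left ?_ (IsBigO.prod_left ?_ (IsBigO.prod_left ?_ ?_)))
  · simpa using aux 0 y.1
  · simpa using aux 1 y.2.1
  · simpa using aux 2 y.2.2.1
  · simpa using aux 2 y.2.2.2.1
  · simpa using aux 3 y.2.2.2.2

lemma scl_tendsto (y : C5) : Tendsto (fun t : ℝ => scl t y) (𝓝 0) (𝓝 0) :=
  (scl_isBigO y).trans_tendsto tendsto_id

lemma Good.of_isBigO {F : C5 → ℂ} (h : F =O[𝓝 0] fun x => ‖x‖ ^ 5) : Good F := by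
  refine ⟨0, 0, 0, 0, 0, 0, fun y => ⟨0, 0, 0, 0, ?_⟩⟩
  have h1 := h.comp_tendsto (scl_tendsto y)
  have h2 : (fun t : ℝ => ‖scl t y‖ ^ 5) =O[𝓝 0] fun t : ℝ => t ^ 5 := (scl_isBigO y).norm_left.pow 5
  simpa [Function.comp_def] using h1.trans h2

lemma Good.monomial (n : Fin 5 → ℕ) : Good (fun x => ∏ i, crd x i ^ n i) := by
  have hs : ∀ (t : ℝ) (y : C5), ∏ i, crd (scl t y) i ^ n i
      = (t : ℂ) ^ (n 0 + 2 * n 1 + 3 * n 2 + 3 * n 3 + 4 * n 4) * ∏ i, crd y i ^ n i := by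
    intro t y
    simp only [Fin.prod_univ_five, crd_scl]
    simp [wt]
    ring
  obtain ⟨N, hN⟩ : ∃ N, N = n 0 + 2 * n 1 + 3 * n 2 + 3 * n 3 + 4 * n 4 := ⟨_, rfl⟩
  have hlow : N ≤ 3 → Good (fun x => ∏ i, crd x i ^ n i) := by
    intro hN3
    refine ⟨0, 0, 0, 0, 0, 0, fun y => ?_⟩
    refine ⟨if N = 0 then ∏ i, crd y i ^ n i else 0, if N = 1 then ∏ i, crd y i ^ n i else 0,
      if N = 2 then ∏ i, crd y i ^ n i else 0, if N = 3 then ∏ i, crd y i ^ n i else 0, ?_⟩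
    refine (isBigO_zero _ _).congr_left fun t => ?_
    beta_reduce
    rw [hs, ← hN]
    interval_cases N <;> simp
  rcases lt_trichotomy N 4 with h | h | h
  · exact hlow (by omega)
  · have hcase : (n 0 = 4 ∧ n 1 = 0 ∧ n 2 = 0 ∧ n 3 = 0 ∧ n 4 = 0) ∨
      (n 0 = 2 ∧ n 1 = 1 ∧ n 2 = 0 ∧ n 3 = 0 ∧ n 4 = 0) ∨
      (n 0 = 0 ∧ n 1 = 2 ∧ n 2 = 0 ∧ n 3 = 0 ∧ n 4 = 0) ∨
      (n 0 = 1 ∧ n 1 = 0 ∧ n 2 = 1 ∧ n 3 = 0 ∧ n 4 = 0) ∨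
      (n 0 = 1 ∧ n 1 = 0 ∧ n 2 = 0 ∧ n 3 = 1 ∧ n 4 = 0) ∨
      (n 0 = 0 ∧ n 1 = 0 ∧ n 2 = 0 ∧ n 3 = 0 ∧ n 4 = 1) := by
      have h4 : n 4 ≤ 1 := by omega
      have h3 : n 3 ≤ 1 := by omega
      have h2 : n 2 ≤ 1 := by omega
      have h1 : n 1 ≤ 2 := by omega
      generalize n 4 = n4 at *
      generalize n 3 = n3 at *
      generalize n 2 = n2 at *
      generalize n 1 = n1 at *
      clear hs hlow
      interval_cases n4 <;> interval_cases n3 <;> interval_cases n2 <;> interval_cases n1 <;> omega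
    have hfin : ∀ α β γ δ ε κ : ℂ, (∀ y : C5, ∏ i, crd y i ^ n i =
        α * y.1 ^ 4 + β * (y.1 ^ 2 * y.2.1) + γ * y.2.1 ^ 2 + δ * (y.1 * y.2.2.1)
        + ε * (y.1 * y.2.2.2.1) + κ * y.2.2.2.2) → Good (fun x => ∏ i, crd x i ^ n i) := by
      intro α β γ δ ε κ hy
      refine ⟨α, β, γ, δ, ε, κ, fun y => ⟨0, 0, 0, 0, (isBigO_zero _ _).congr_left fun t => ?_⟩⟩
      beta_reduce
      rw [hs, ← hN, h, hy]
      ring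
    rcases hcase with h | h | h | h | h | h <;> obtain ⟨h0, h1, h2, h3, h4⟩ := h
    · apply hfin 1 0 0 0 0 0; intro y; simp [Fin.prod_univ_five, crd, *]
    · apply hfin 0 1 0 0 0 0; intro y; simp [Fin.prod_univ_five, crd, *]
    · apply hfin 0 0 1 0 0 0; intro y; simp [Fin.prod_univ_five, crd, *]
    · apply hfin 0 0 0 1 0 0; intro y; simp [Fin.prod_univ_five, crd, *]
    · apply hfin 0 0 0 0 1 0; intro y; simp [Fin.prod_univ_five, crd, *]
    · apply hfin 0 0 0 0 0 1; intro y; simp [Fin.prod_univ_five, crd, *]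
  · refine ⟨0, 0, 0, 0, 0, 0, fun y => ⟨0, 0, 0, 0, ?_⟩⟩
    simp only [hs, ← hN]
    refine IsBigO.of_bound ‖∏ i, crd y i ^ n i‖ ?_
    filter_upwards [ball_mem_nhds (0 : ℝ) one_pos] with t ht
    rw [mem_ball_zero_iff] at ht
    simp only [mul_zero, zero_mul, add_zero, sub_zero]
    rw [norm_mul, norm_pow, Complex.norm_real, mul_comm, norm_pow]
    gcongr ?_ * ?_
    exact pow_le_pow_of_le_one (norm_nonneg _) ht.le h

lemma Good.of_differentiableOn {G : C5 → ℂ} {U : Set C5} (hU : IsOpen U) (h0 : (0 : C5) ∈ U)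
    (hG : DifferentiableOn ℂ G U) : Good G := by
  obtain ⟨p, hp⟩ := taylor_C5 5 hU h0 hG
  have h1 : Good (fun x => ∑ k ∈ Finset.range 5, p k (fun _ => x)) := by
    apply Good.sum
    intro k
    have : (fun x => p k (fun _ => x)) =
        fun x => ∑ r : Fin k → Fin 5, (∏ i, crd x (r i)) * p k (fun i => bas (r i)) := by
      funext x
      conv_lhs => rw [crd_bas x]
      rw [(p k).map_sum]
      refine Finset.sum_congr rfl fun r _ => ?_
      rw [(p k).map_smul_univ, smul_eq_mul]
    rw [this]
    apply Good.sum
    intro r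
    apply Good.mul_const
    have h2 : (fun x => ∏ i, crd x (r i)) = fun x =>
        ∏ j, crd x j ^ (Finset.univ.filter fun i => r i = j).card := by
      funext x
      rw [← Finset.prod_fiberwise Finset.univ r (fun i => crd x (r i))]
      refine Finset.prod_congr rfl fun j _ => ?_
      rw [Finset.prod_congr rfl (g := fun _ => crd x j), Finset.prod_const]
      intro i hi
      rw [(Finset.mem_filter.1 hi).2]
    rw [h2]
    exact Good.monomial _
  have := h1.add (Good.of_isBigO hp)
  simpa using this
lemma isBigO_step {r e : ℝ} {E : ℝ → ℝ} {n : ℕ}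
    (h : (fun t : ℝ => r + t * E t) =O[𝓝[≠] 0] fun t : ℝ => t ^ (n + 1))
    (hE : Tendsto E (𝓝[≠] 0) (𝓝 e)) : E =O[𝓝[≠] 0] fun t : ℝ => t ^ n := by
  have ht : Tendsto (fun t : ℝ => t) (𝓝[≠] 0) (𝓝 0) := tendsto_nhdsWithin_of_tendsto_nhds tendsto_id
  have h1 : Tendsto (fun t : ℝ => r + t * E t) (𝓝[≠] 0) (𝓝 0) := by
    refine h.trans_tendsto ?_
    simpa using ht.pow (n + 1)
  have h2 : Tendsto (fun t : ℝ => r + t * E t) (𝓝[≠] 0) (𝓝 r) := by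
    simpa using tendsto_const_nhds.add (ht.mul hE)
  have hr : r = 0 := tendsto_nhds_unique h2 h1
  obtain ⟨C, hC⟩ := h.bound
  refine IsBigO.of_bound C ?_
  filter_upwards [hC, self_mem_nhdsWithin] with t h3 ht0
  rw [hr, zero_add, norm_mul, pow_succ, norm_mul] at h3
  have : 0 < ‖t‖ := norm_pos_iff.2 ht0
  have h4 : ‖t‖ * ‖E t‖ ≤ ‖t‖ * (C * ‖t ^ n‖) := by linarith
  exact le_of_mul_le_mul_left h4 this

lemma coeff_four {r0 r1 r2 r3 r4 s : ℝ} {S : ℝ → ℝ} (hS : Tendsto S (𝓝[≠] 0) (𝓝 s))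
    (h : (fun t : ℝ => t ^ 4 * S t - (r0 + t * r1 + t ^ 2 * r2 + t ^ 3 * r3 + t ^ 4 * r4))
      =O[𝓝[≠] 0] fun t : ℝ => t ^ 5) : r4 = s := by
  have ht : Tendsto (fun t : ℝ => t) (𝓝[≠] 0) (𝓝 0) := tendsto_nhdsWithin_of_tendsto_nhds tendsto_id
  have T4 : Tendsto (fun t => S t - r4) (𝓝[≠] 0) (𝓝 (s - r4)) := hS.sub_const _
  have T3 := (tendsto_const_nhds (x := -r3)).add (ht.mul T4)
  have T2 := (tendsto_const_nhds (x := -r2)).add (ht.mul T3)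
  have T1 := (tendsto_const_nhds (x := -r1)).add (ht.mul T2)
  have h0 : (fun t : ℝ => -r0 + t * (-r1 + t * (-r2 + t * (-r3 + t * (S t - r4)))))
      =O[𝓝[≠] 0] fun t : ℝ => t ^ (4 + 1) := h.congr_left fun t => by ring
  have h4 := isBigO_step (isBigO_step (isBigO_step (isBigO_step h0 T1) T2) T3) T4
  have h5 : Tendsto (fun t => S t - r4) (𝓝[≠] 0) (𝓝 0) := by
    refine h4.trans_tendsto ?_
    simpa using ht
  have := tendsto_nhds_unique T4 h5
  linarith

lemma scl_mem {a : ℂ} {b : ℝ} {y : C5} (hy : y ∈ BModel a b) (t : ℝ) : scl t y ∈ BModel a b := by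
  obtain ⟨z, w1, w2, w3, w4⟩ := y
  obtain ⟨h1, h2, h3, h4⟩ := hy
  dsimp only at h1 h2 h3 h4
  have key : ∀ (n : ℕ) (w : ℂ), ((t : ℂ) ^ n * w).im = t ^ n * w.im := by
    intro n w; rw [← Complex.ofReal_pow, Complex.im_ofReal_mul]
  have key' : ∀ (n : ℕ) (w : ℂ), ((t : ℂ) ^ n * w).re = t ^ n * w.re := by
    intro n w; rw [← Complex.ofReal_pow, Complex.re_ofReal_mul]
  have e1 : (t * z) ^ 2 * conj (t * z) = (t : ℂ) ^ 3 * (z ^ 2 * conj z) := by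
    rw [map_mul, Complex.conj_ofReal]; ring
  have e2 : a * (t * z) ^ 3 * conj (t * z) = (t : ℂ) ^ 4 * (a * z ^ 3 * conj z) := by
    rw [map_mul, Complex.conj_ofReal]; ring
  refine ⟨?_, ?_, ?_, ?_⟩ <;> dsimp only [scl]
  · rw [key, h1, Complex.normSq_mul, Complex.normSq_ofReal]; ring
  · rw [e1, key, key', h2]; ring
  · rw [e1, key, key, h3]; ring
  · rw [e2, key, key', h4, Complex.normSq_mul, Complex.normSq_ofReal]; ring

lemma scl_hasDerivAt (y : C5) :
    HasDerivAt (fun t : ℝ => scl t y) (y.1 • ((1, 0, 0, 0, 0) : C5)) 0 := by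
  have aux : ∀ (n : ℕ) (c : ℂ), HasDerivAt (fun t : ℝ => (t : ℂ) ^ (n + 2) * c) 0 0 := by
    intro n c
    have h6 : HasDerivAt (fun u : ℝ => (u : ℂ)) 1 0 := Complex.ofRealCLM.hasDerivAt
    simpa using (h6.pow (n + 2)).mul_const c
  have aux1 : HasDerivAt (fun t : ℝ => (t : ℂ) * y.1) y.1 0 := by
    have h6 : HasDerivAt (fun u : ℝ => (u : ℂ)) 1 0 := Complex.ofRealCLM.hasDerivAt
    simpa using h6.mul_const y.1
  have := aux1.prodMk ((aux 0 y.2.1).prodMk ((aux 1 y.2.2.1).prodMk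
    ((aux 1 y.2.2.2.1).prodMk (aux 2 y.2.2.2.2))))
  simpa [scl] using this

lemma im_zero {c : ℂ} (h : ∀ z : ℂ, (z * c).im = 0) : c = 0 := by
  have h1 := h 1
  have h2 := h Complex.I
  simp at h1 h2
  exact Complex.ext h2 h1

lemma nec_dir (a a' : ℂ) (b b' : ℝ) (hb : b ≠ 0) (hb' : b' ≠ 0)
    (h : BiholEquiv a b a' b') :
    a * conj a / (b : ℂ) ^ 2 = a' * conj a' / (b' : ℂ) ^ 2 := by
  obtain ⟨U, V, Φ, Ψ, hU, hV, hU0, hV0, hΦ, hΨ, hΦ0, -, -, hΨΦ, -, himg⟩ := h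
  have hdΦ : HasFDerivAt Φ (fderiv ℂ Φ 0) 0 := (hΦ.differentiableAt (hU.mem_nhds hU0)).hasFDerivAt
  obtain ⟨L, hL⟩ : ∃ L, L = fderiv ℂ Φ 0 (1, 0, 0, 0, 0) := ⟨_, rfl⟩
  have hL0 : L ≠ 0 := by
    intro h0
    have h1 : HasFDerivAt Ψ (fderiv ℂ Ψ 0) (Φ 0) := by
      rw [hΦ0]; exact (hΨ.differentiableAt (hV.mem_nhds hV0)).hasFDerivAt
    have h2 := h1.comp 0 hdΦ
    have h3 : HasFDerivAt (Ψ ∘ Φ) (ContinuousLinearMap.id ℂ C5) 0 := by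
      refine (hasFDerivAt_id (0 : C5)).congr_of_eventuallyEq ?_
      filter_upwards [hU.mem_nhds hU0] with p hp using hΨΦ p hp
    have h4 := congrArg (fun D : C5 →L[ℂ] C5 => D (1, 0, 0, 0, 0)) (h2.unique h3)
    simp [← hL, h0] at h4
    exact one_ne_zero (congrArg Prod.fst h4).symm
  -- the image curve
  have hder : ∀ y : C5, HasDerivAt (fun t : ℝ => Φ (scl t y)) (y.1 • L) 0 := by
    intro y
    have h0 : scl 0 y = 0 := by simp [scl]
    have h1 : HasFDerivAt Φ ((fderiv ℂ Φ 0).restrictScalars ℝ) (scl 0 y) := by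
      rw [h0]; exact hdΦ.restrictScalars ℝ
    have h2 := h1.comp_hasDerivAt (0 : ℝ) (scl_hasDerivAt y)
    rw [ContinuousLinearMap.coe_restrictScalars', map_smul, ← hL] at h2
    exact h2
  have hslope : ∀ y : C5, Tendsto (fun t : ℝ => t⁻¹ • Φ (scl t y)) (𝓝[≠] 0) (𝓝 (y.1 • L)) := by
    intro y
    have h0 : scl 0 y = 0 := by simp [scl]
    have := (hder y).tendsto_slope_zero
    simpa [h0, hΦ0] using this
  have hmem : ∀ y ∈ BModel a b, ∀ᶠ t : ℝ in 𝓝[≠] 0, Φ (scl t y) ∈ BModel a' b' := by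
    intro y hy
    have h1 : ∀ᶠ t : ℝ in 𝓝[≠] 0, scl t y ∈ U :=
      (scl_tendsto y).mono_left nhdsWithin_le_nhds (hU.mem_nhds hU0)
    filter_upwards [h1] with t ht
    have : Φ (scl t y) ∈ Φ '' (BModel a b ∩ U) := ⟨_, ⟨scl_mem hy t, ht⟩, rfl⟩
    rw [himg] at this
    exact this.1
  have ht : Tendsto (fun t : ℝ => t) (𝓝[≠] 0) (𝓝 0) := tendsto_nhdsWithin_of_tendsto_nhds tendsto_id
  -- the rescaled first component and the defining equations
  have hw : ∀ y : C5, Tendsto (fun t : ℝ => t⁻¹ • (Φ (scl t y)).1) (𝓝[≠] 0) (𝓝 (L.1 * y.1)) := by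
    intro y
    have := (continuous_fst.tendsto _).comp (hslope y)
    simpa [Function.comp_def, mul_comm] using this
  have hunscale : ∀ (t : ℝ), t ≠ 0 → ∀ z : ℂ, z = (t : ℂ) * (t⁻¹ • z) := by
    intro t ht z
    rw [Complex.real_smul, Complex.ofReal_inv]
    have : (t : ℂ) ≠ 0 := by exact_mod_cast ht
    field_simp
  have heqs : ∀ y ∈ BModel a b, ∀ᶠ t : ℝ in 𝓝[≠] 0,
      (t⁻¹ • Φ (scl t y)).2.1.im = t * Complex.normSq (t⁻¹ • (Φ (scl t y)).1) ∧
      (t⁻¹ • Φ (scl t y)).2.2.1.im =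
        t ^ 2 * (2 * ((t⁻¹ • (Φ (scl t y)).1) ^ 2 * conj (t⁻¹ • (Φ (scl t y)).1)).re) ∧
      (t⁻¹ • Φ (scl t y)).2.2.2.1.im =
        t ^ 2 * (2 * ((t⁻¹ • (Φ (scl t y)).1) ^ 2 * conj (t⁻¹ • (Φ (scl t y)).1)).im) ∧
      (t⁻¹ • Φ (scl t y)).2.2.2.2.im =
        t ^ 3 * (2 * (a' * (t⁻¹ • (Φ (scl t y)).1) ^ 3 * conj (t⁻¹ • (Φ (scl t y)).1)).re
          + b' * Complex.normSq (t⁻¹ • (Φ (scl t y)).1) ^ 2) ∧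
      (Φ (scl t y)).2.2.2.2.im =
        t ^ 4 * (2 * (a' * (t⁻¹ • (Φ (scl t y)).1) ^ 3 * conj (t⁻¹ • (Φ (scl t y)).1)).re
          + b' * Complex.normSq (t⁻¹ • (Φ (scl t y)).1) ^ 2) := by
    intro y hy
    filter_upwards [hmem y hy, self_mem_nhdsWithin] with t hM ht0
    have ht0' : t ≠ 0 := ht0
    have hinv : (t⁻¹ • Φ (scl t y)) ∈ {p : C5 | True} := trivial
    have hX : Φ (scl t y) = ((Φ (scl t y)).1, (Φ (scl t y)).2) := rfl
    generalize Φ (scl t y) = X at *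
    obtain ⟨z, w1, w2, w3, w4⟩ := X
    obtain ⟨h1, h2, h3, h4⟩ := hM
    dsimp only at h1 h2 h3 h4
    have hz := hunscale t ht0' z
    dsimp only [Prod.smul_mk]
    generalize t⁻¹ • z = x at *
    subst hz
    have key : ∀ (n : ℕ) (w : ℂ), ((t : ℂ) ^ n * w).im = t ^ n * w.im := by
      intro n w; rw [← Complex.ofReal_pow, Complex.im_ofReal_mul]
    have key' : ∀ (n : ℕ) (w : ℂ), ((t : ℂ) ^ n * w).re = t ^ n * w.re := by
      intro n w; rw [← Complex.ofReal_pow, Complex.re_ofReal_mul]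
    have e1 : (t * x) ^ 2 * conj (t * x) = (t : ℂ) ^ 3 * (x ^ 2 * conj x) := by
      rw [map_mul, Complex.conj_ofReal]; ring
    have e2 : a' * (t * x) ^ 3 * conj (t * x) = (t : ℂ) ^ 4 * (a' * x ^ 3 * conj x) := by
      rw [map_mul, Complex.conj_ofReal]; ring
    rw [Complex.normSq_mul, Complex.normSq_ofReal] at h1
    rw [e1, key'] at h2
    rw [e1, key] at h3
    rw [e2, key', Complex.normSq_mul, Complex.normSq_ofReal] at h4
    simp only [Complex.smul_im, smul_eq_mul]
    rw [h1, h2, h3, h4]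
    refine ⟨?_, ?_, ?_, ?_, ?_⟩
    · field_simp
    · field_simp
    · field_simp
    · field_simp
    · ring
  -- continuity of the defining functions
  have c1 : Continuous fun z : ℂ => Complex.normSq z := Complex.continuous_normSq
  have c2 : Continuous fun z : ℂ => 2 * (z ^ 2 * conj z).re := by fun_prop
  have c3 : Continuous fun z : ℂ => 2 * (z ^ 2 * conj z).im := by fun_prop
  have c4 : Continuous fun z : ℂ => 2 * (a' * z ^ 3 * conj z).re + b' * Complex.normSq z ^ 2 := by
    fun_prop
  -- a point of the model above each z
  have hpt : ∀ z : ℂ, ∃ y ∈ BModel a b, y.1 = z := fun z =>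
    ⟨(z, ⟨0, Complex.normSq z⟩, ⟨0, 2 * (z ^ 2 * conj z).re⟩, ⟨0, 2 * (z ^ 2 * conj z).im⟩,
      ⟨0, 2 * (a * z ^ 3 * conj z).re + b * Complex.normSq z ^ 2⟩), ⟨rfl, rfl, rfl, rfl⟩, rfl⟩
  have hvan : ∀ (pr : C5 → ℂ), Continuous pr → (∀ (z : ℂ) (p : C5), pr (z • p) = z * pr p) →
      (∀ y ∈ BModel a b, Tendsto (fun t : ℝ => (pr (t⁻¹ • Φ (scl t y))).im) (𝓝[≠] 0) (𝓝 0)) →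
      pr L = 0 := by
    intro pr hc hlin hlim
    apply im_zero
    intro z
    obtain ⟨y, hy, rfl⟩ := hpt z
    have h1 := ((Complex.continuous_im.comp hc).tendsto _).comp (hslope y)
    have := tendsto_nhds_unique h1 (hlim y hy)
    simpa [hlin] using this
  have hLa : L.2.1 = 0 := by
    apply hvan (fun p => p.2.1) (by fun_prop) (fun _ _ => rfl)
    intro y hy
    have h1 := ht.mul ((c1.tendsto _).comp (hw y))
    rw [zero_mul] at h1
    refine h1.congr' ?_
    filter_upwards [heqs y hy] with t h using h.1.symm
  have hLb : L.2.2.1 = 0 := by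
    apply hvan (fun p => p.2.2.1) (by fun_prop) (fun _ _ => rfl)
    intro y hy
    have h1 := (ht.pow 2).mul ((c2.tendsto _).comp (hw y))
    rw [zero_pow two_ne_zero, zero_mul] at h1
    refine h1.congr' ?_
    filter_upwards [heqs y hy] with t h using h.2.1.symm
  have hLc : L.2.2.2.1 = 0 := by
    apply hvan (fun p => p.2.2.2.1) (by fun_prop) (fun _ _ => rfl)
    intro y hy
    have h1 := (ht.pow 2).mul ((c3.tendsto _).comp (hw y))
    rw [zero_pow two_ne_zero, zero_mul] at h1
    refine h1.congr' ?_
    filter_upwards [heqs y hy] with t h using h.2.2.1.symm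
  have hLd : L.2.2.2.2 = 0 := by
    apply hvan (fun p => p.2.2.2.2) (by fun_prop) (fun _ _ => rfl)
    intro y hy
    have h1 := (ht.pow 3).mul ((c4.tendsto _).comp (hw y))
    rw [zero_pow three_ne_zero, zero_mul] at h1
    refine h1.congr' ?_
    filter_upwards [heqs y hy] with t h using h.2.2.2.1.symm
  have hl : L.1 ≠ 0 := by
    intro h0
    apply hL0
    exact Prod.ext h0 (Prod.ext hLa (Prod.ext hLb (Prod.ext hLc hLd)))
  -- the weighted expansion of the last component
  have hd4 : DifferentiableOn ℂ (fun p => (Φ p).2.2.2.2) U :=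
    hΦ.snd.snd.snd.snd
  obtain ⟨α, β, γ, δ, ε, κ, hgood⟩ := Good.of_differentiableOn hU hU0 hd4
  obtain ⟨-, k1, k2, k3⟩ := alg_core a a' L.1 b b' α β γ δ ε κ (by
    intro y hy
    obtain ⟨q0, q1, q2, q3, hO⟩ := hgood y
    refine coeff_four (r0 := q0.im) (r1 := q1.im) (r2 := q2.im) (r3 := q3.im)
      ((c4.tendsto _).comp (hw y)) ?_
    have hO' := hO.mono (nhdsWithin_le_nhds (s := {(0 : ℝ)}ᶜ))
    have hO2 : (fun t : ℝ => ((Φ (scl t y)).2.2.2.2 - (q0 + t * q1 + t ^ 2 * q2 + t ^ 3 * q3 +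
      t ^ 4 * (α * y.1 ^ 4 + β * (y.1 ^ 2 * y.2.1) + γ * y.2.1 ^ 2 + δ * (y.1 * y.2.2.1)
        + ε * (y.1 * y.2.2.2.1) + κ * y.2.2.2.2))).im) =O[𝓝[≠] 0] fun t : ℝ => t ^ 5 :=
      (IsBigO.of_bound 1 (Eventually.of_forall fun t => by
        rw [one_mul]; exact Complex.abs_im_le_norm _)).trans hO'
    refine hO2.congr' ?_ EventuallyEq.rfl
    filter_upwards [heqs y hy] with t h
    generalize α * y.1 ^ 4 + β * (y.1 ^ 2 * y.2.1) + γ * y.2.1 ^ 2 + δ * (y.1 * y.2.2.1)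
        + ε * (y.1 * y.2.2.2.1) + κ * y.2.2.2.2 = c
    have key : ∀ (n : ℕ) (w : ℂ), ((t : ℂ) ^ n * w).im = t ^ n * w.im := by
      intro n w; rw [← Complex.ofReal_pow, Complex.im_ofReal_mul]
    simp only [Complex.sub_im, Complex.add_im, key, Complex.im_ofReal_mul, h.2.2.2.2,
      Function.comp_apply])
  exact modulus_core a a' L.1 b b' hb hb' hl κ.re k1 k2 k3

/-- for nonzero `a, a' ∈ ℂ` and nonzero `b, b' ∈ ℝ`, the models `M(a,b)`
and `M(a',b')` are biholomorphically equivalent iff `a·conj a / b² = a'·conj a' / b'²`. -/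
theorem beloshapka_moduli_invariant (a a' : ℂ) (b b' : ℝ)
    (ha : a ≠ 0) (ha' : a' ≠ 0) (hb : b ≠ 0) (hb' : b' ≠ 0) :
    BiholEquiv a b a' b' ↔
      a * conj a / (b : ℂ) ^ 2 = a' * conj a' / (b' : ℂ) ^ 2 := by
  exact ⟨nec_dir a a' b b' hb hb', suff_dir a a' b b' ha ha' hb hb'⟩
end
end

section
/- Let a ∈ ℂ be nonzero and b ∈ ℝ. The set of all maps X : ℂ⁵ → ℂ⁵ whose five components are polynomials in the complex variables (z, w₁, w₂, w₃, w₄) and which satisfy, for every point p ∈ M(a,b) and every k ∈ {1,2,3,4}, Dρₖ(p)[X(p)] = 0 — where Dρₖ(p) is the Fréchet derivative over ℝ of ρₖ at p and X(p) ∈ ℂ⁵ is viewed as a real tangent vector — is a real vector subspace of dimension 7. (This space is the Lie algebra of infinitesimal CR-automorphisms of the Beloshapka model M(a,b), the condition expressing that the real part of the holomorphic vector field X is tangent to M(a,b).) -/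
open ComplexConjugate

noncomputable section

open MvPolynomial in
/-- `X : ℂ⁵ → ℂ⁵` has polynomial components in the complex variables `(z,w₁,w₂,w₃,w₄)`. -/
def IsPolyMap (F : C5 → C5) : Prop :=
  ∃ Q : Fin 5 → MvPolynomial (Fin 5) ℂ, ∀ p : C5,
    F p = (eval ![p.1, p.2.1, p.2.2.1, p.2.2.2.1, p.2.2.2.2] (Q 0),
           eval ![p.1, p.2.1, p.2.2.1, p.2.2.2.1, p.2.2.2.2] (Q 1),
           eval ![p.1, p.2.1, p.2.2.1, p.2.2.2.1, p.2.2.2.2] (Q 2),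
           eval ![p.1, p.2.1, p.2.2.1, p.2.2.2.1, p.2.2.2.2] (Q 3),
           eval ![p.1, p.2.1, p.2.2.1, p.2.2.2.1, p.2.2.2.2] (Q 4))

/-- The four real defining functions `ρ₁, ρ₂, ρ₃, ρ₄ : ℂ⁵ → ℝ` of `M(a,b)`. -/
def rho (a : ℂ) (b : ℝ) : Fin 4 → (C5 → ℝ) :=
  ![fun p => p.2.1.im - Complex.normSq p.1,
    fun p => p.2.2.1.im - 2 * (p.1 ^ 2 * conj p.1).re,
    fun p => p.2.2.2.1.im - 2 * (p.1 ^ 2 * conj p.1).im,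
    fun p => p.2.2.2.2.im - 2 * (a * p.1 ^ 3 * conj p.1).re - b * Complex.normSq p.1 ^ 2]


/-! ### Part 1 : derivatives of the defining functions -/

theorem fd0 (a : ℂ) (b : ℝ) (p v : C5) :
    fderiv ℝ (rho a b 0) p v = v.2.1.im - 2 * (conj p.1 * v.1).re := by
  have hz : HasFDerivAt (fun q : C5 => q.1) (ContinuousLinearMap.fst ℝ ℂ _) p := hasFDerivAt_fst
  have hc := Complex.conjCLE.toContinuousLinearMap.hasFDerivAt.comp p hz
  have hw : HasFDerivAt (fun q : C5 => q.2.1.im) _ p :=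
    Complex.imCLM.hasFDerivAt.comp p (hasFDerivAt_fst.comp p hasFDerivAt_snd)
  have h := hw.sub (Complex.reCLM.hasFDerivAt.comp p (hz.mul hc))
  have e : rho a b 0 = fun q : C5 => q.2.1.im - (q.1 * conj q.1).re := by
    funext q
    simp [rho, Complex.normSq_apply]
  rw [e]
  refine (congrArg (fun L => L v) (HasFDerivAt.fderiv h)).trans ?_
  simp
  ring

theorem fd1 (a : ℂ) (b : ℝ) (p v : C5) :
    fderiv ℝ (rho a b 1) p v
      = v.2.2.1.im - 2 * ((2 * p.1 * conj p.1 + conj p.1 ^ 2) * v.1).re := by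
  have hz : HasFDerivAt (fun q : C5 => q.1) (ContinuousLinearMap.fst ℝ ℂ _) p := hasFDerivAt_fst
  have hc := Complex.conjCLE.toContinuousLinearMap.hasFDerivAt.comp p hz
  have hw : HasFDerivAt (fun q : C5 => q.2.2.1.im) _ p :=
    Complex.imCLM.hasFDerivAt.comp p
      (hasFDerivAt_fst.comp p (hasFDerivAt_snd.comp p hasFDerivAt_snd))
  have h := hw.sub ((Complex.reCLM.hasFDerivAt.comp p ((hz.mul hz).mul hc)).const_mul 2)
  have e : rho a b 1 = fun q : C5 => q.2.2.1.im - 2 * (q.1 * q.1 * conj q.1).re := by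
    funext q
    simp [rho, pow_two]
  rw [e]
  refine (congrArg (fun L => L v) (HasFDerivAt.fderiv h)).trans ?_
  simp [pow_two]
  ring

theorem fd2 (a : ℂ) (b : ℝ) (p v : C5) :
    fderiv ℝ (rho a b 2) p v
      = v.2.2.2.1.im
        - 2 * (-Complex.I * (2 * p.1 * conj p.1 - conj p.1 ^ 2) * v.1).re := by
  have hz : HasFDerivAt (fun q : C5 => q.1) (ContinuousLinearMap.fst ℝ ℂ _) p := hasFDerivAt_fst
  have hc := Complex.conjCLE.toContinuousLinearMap.hasFDerivAt.comp p hz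
  have hw : HasFDerivAt (fun q : C5 => q.2.2.2.1.im) _ p :=
    Complex.imCLM.hasFDerivAt.comp p
      (hasFDerivAt_fst.comp p (hasFDerivAt_snd.comp p (hasFDerivAt_snd.comp p hasFDerivAt_snd)))
  have h := hw.sub ((Complex.imCLM.hasFDerivAt.comp p ((hz.mul hz).mul hc)).const_mul 2)
  have e : rho a b 2 = fun q : C5 => q.2.2.2.1.im - 2 * (q.1 * q.1 * conj q.1).im := by
    funext q
    simp [rho, pow_two]
  rw [e]
  refine (congrArg (fun L => L v) (HasFDerivAt.fderiv h)).trans ?_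
  simp [pow_two]
  ring

theorem fd3 (a : ℂ) (b : ℝ) (p v : C5) :
    fderiv ℝ (rho a b 3) p v
      = v.2.2.2.2.im
        - 2 * ((3 * a * p.1 ^ 2 * conj p.1 + conj a * conj p.1 ^ 3
            + 2 * b * p.1 * conj p.1 ^ 2) * v.1).re := by
  have hz : HasFDerivAt (fun q : C5 => q.1) (ContinuousLinearMap.fst ℝ ℂ _) p := hasFDerivAt_fst
  have hc := Complex.conjCLE.toContinuousLinearMap.hasFDerivAt.comp p hz
  have hw : HasFDerivAt (fun q : C5 => q.2.2.2.2.im) _ p :=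
    Complex.imCLM.hasFDerivAt.comp p
      (hasFDerivAt_snd.comp p (hasFDerivAt_snd.comp p (hasFDerivAt_snd.comp p hasFDerivAt_snd)))
  have h := (hw.sub ((Complex.reCLM.hasFDerivAt.comp p
      (((hz.mul (hz.mul hz)).mul hc).const_mul a)).const_mul 2)).sub
      ((Complex.reCLM.hasFDerivAt.comp p ((hz.mul hc).mul (hz.mul hc))).const_mul b)
  have e : rho a b 3 = fun q : C5 => q.2.2.2.2.im - 2 * (a * (q.1 * (q.1 * q.1) * conj q.1)).re
        - b * (q.1 * conj q.1 * (q.1 * conj q.1)).re := by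
    funext q
    simp [rho, pow_succ, Complex.normSq_apply]
    ring
  rw [e]
  refine (congrArg (fun L => L v) (HasFDerivAt.fderiv h)).trans ?_
  simp [pow_succ]
  ring

/-! ### Part 2 : polynomial calculus -/

theorem eval_curve (P : MvPolynomial (Fin 5) ℂ) (x : ℝ → Fin 5 → ℂ) (v : Fin 5 → ℂ) (t : ℝ)
    (hx : ∀ i, HasDerivAt (fun s => x s i) (v i) t) :
    HasDerivAt (fun s => MvPolynomial.eval (x s) P)
      (∑ i, v i * MvPolynomial.eval (x t) (MvPolynomial.pderiv i P)) t := by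
  induction P using MvPolynomial.induction_on with
  | C c => simpa using hasDerivAt_const t c
  | add p q hp hq =>
    simp only [map_add, mul_add, Finset.sum_add_distrib]
    exact hp.add hq
  | mul_X p n hp =>
    simp only [map_mul, MvPolynomial.eval_X]
    refine (hp.mul (hx n)).congr_deriv ?_
    simp only [Derivation.leibniz, MvPolynomial.pderiv_X, map_add, smul_eq_mul, map_mul,
      MvPolynomial.eval_X, mul_add, Finset.sum_add_distrib, Finset.sum_mul]
    rw [add_comm]
    congr 1
    · rw [Finset.sum_eq_single n]
      · simp; ring
      · intro j _ hj
        simp [hj.symm]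
      · simp
    · refine Finset.sum_congr rfl fun i _ => by ring

theorem eval_indep (P : MvPolynomial (Fin 5) ℂ)
    (h : ∀ j : Fin 4, MvPolynomial.pderiv j.succ P = 0) (z w1 w2 w3 w4 : ℂ) :
    MvPolynomial.eval ![z, w1, w2, w3, w4] P = MvPolynomial.eval ![z, 0, 0, 0, 0] P := by
  have key : ∀ t : ℝ, HasDerivAt
      (fun s : ℝ => MvPolynomial.eval ![z, s * w1, s * w2, s * w3, s * w4] P) 0 t := by
    intro t
    have hd : ∀ w : ℂ, HasDerivAt (fun s : ℝ => (s : ℂ) * w) w t := by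
      intro w
      simpa using (Complex.ofRealCLM.hasDerivAt (x := t)).mul_const w
    refine (eval_curve P (fun s => ![z, s * w1, s * w2, s * w3, s * w4]) ![0, w1, w2, w3, w4] t
      ?_).congr_deriv ?_
    · intro i
      fin_cases i
      · exact hasDerivAt_const _ _
      · exact hd w1
      · exact hd w2
      · exact hd w3
      · exact hd w4
    · rw [Fin.sum_univ_succ]
      simp [h]
  have := is_const_of_deriv_eq_zero (fun t => (key t).differentiableAt)
    (fun t => (key t).deriv) 1 0
  simpa using this

theorem hasDerivAt_shift (P : MvPolynomial (Fin 5) ℂ) (x : Fin 5 → ℂ) (j : Fin 5) :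
    HasDerivAt (fun s : ℝ => MvPolynomial.eval (x + (s : ℂ) • Pi.single j 1) P)
      (MvPolynomial.eval x (MvPolynomial.pderiv j P)) 0 := by
  have := eval_curve P (fun s => x + (s : ℂ) • Pi.single j 1) (Pi.single j 1) 0 (by
    intro i
    have := ((Complex.ofRealCLM.hasDerivAt (x := (0:ℝ))).mul_const
      ((Pi.single j 1 : Fin 5 → ℂ) i)).const_add (x i)
    simpa using this)
  refine this.congr_deriv ?_
  rw [Finset.sum_eq_single j]
  · simp
  · intro i _ hi; simp [hi]
  · simp

theorem pderiv_degree (P : MvPolynomial (Fin 5) ℂ) (j : Fin 5) (n : ℕ)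
    (h : P.totalDegree ≤ n + 1) : (MvPolynomial.pderiv j P).totalDegree ≤ n := by
  rw [P.as_sum, map_sum]
  refine MvPolynomial.totalDegree_finsetSum_le fun m hm => ?_
  rw [MvPolynomial.pderiv_monomial]
  by_cases hj : m j = 0
  · simp [hj]
  refine (MvPolynomial.totalDegree_monomial_le _ _).trans ?_
  have h1 := (MvPolynomial.le_totalDegree hm).trans h
  have h2 : (m - Finsupp.single j 1) + Finsupp.single j 1 = m := by
    apply tsub_add_cancel_of_le
    simpa using Nat.one_le_iff_ne_zero.mpr hj
  have h3 : m.degree = (m - Finsupp.single j 1).degree + 1 := by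
    conv_lhs => rw [← h2]
    simp
  have h4 : (m.sum fun _ e => e) = m.degree := rfl
  show (m - Finsupp.single j 1).degree ≤ n
  omega

/-! ### Part 3 : complexification -/

theorem entire_zero (g : ℂ → ℂ) (hg : Differentiable ℂ g) (h : ∀ x : ℝ, g x = 0) (z : ℂ) :
    g z = 0 := by
  have h1 : AnalyticOnNhd ℂ g Set.univ := fun x _ => hg.analyticAt x
  have h2 : AnalyticOnNhd ℂ (fun _ : ℂ => (0:ℂ)) Set.univ := fun x _ => analyticAt_const
  have := h1.eq_of_frequently_eq h2 (z₀ := 0) (by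
    have hu : Filter.Tendsto (fun n : ℕ => (((1 / ((n : ℝ) + 1) : ℝ)) : ℂ)) Filter.atTop
        (nhdsWithin 0 {0}ᶜ) := by
      rw [tendsto_nhdsWithin_iff]
      constructor
      · have := (Complex.continuous_ofReal.tendsto 0).comp
          (tendsto_one_div_add_atTop_nhds_zero_nat (𝕜 := ℝ))
        simpa [Function.comp_def] using this
      · refine Filter.Eventually.of_forall fun n => ?_
        simp only [Set.mem_compl_iff, Set.mem_singleton_iff, Complex.ofReal_eq_zero]
        positivity
    exact hu.frequently (Filter.Frequently.of_forall fun n => h _))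
  exact congrFun this z

theorem complexify (h : ℂ → ℂ → ℂ) (hd : Differentiable ℂ (fun q : ℂ × ℂ => h q.1 q.2))
    (h0 : ∀ z, h z (conj z) = 0) (z ζ : ℂ) : h z ζ = 0 := by
  have s1 : ∀ (y : ℝ) (x : ℂ), h (x + Complex.I * y) (x - Complex.I * y) = 0 := by
    intro y
    refine entire_zero _ ?_ ?_
    · exact hd.comp (f := fun x : ℂ => (x + Complex.I * y, x - Complex.I * y)) (by fun_prop)
    · intro x
      have := h0 (x + Complex.I * y)
      simpa [sub_eq_add_neg] using this
  have s2 : ∀ (x y : ℂ), h (x + Complex.I * y) (x - Complex.I * y) = 0 := by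
    intro x
    refine entire_zero _ ?_ ?_
    · exact hd.comp (f := fun y : ℂ => (x + Complex.I * y, x - Complex.I * y)) (by fun_prop)
    · intro y
      exact s1 y x
  have := s2 ((z + ζ) / 2) ((z - ζ) / (2 * Complex.I))
  have hI : Complex.I ≠ 0 := Complex.I_ne_zero
  convert this using 2 <;> field_simp <;> ring

/-! ### Part 4 : comparison of coefficients -/

theorem coef1 (c : Fin 6 → ℂ) (h : ∀ z : ℂ, ∑ j, c j * z ^ (j : ℕ) = 0) (j : Fin 6) : c j = 0 := by
  have hp : (∑ j : Fin 6, Polynomial.C (c j) * Polynomial.X ^ (j : ℕ)) = 0 := by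
    refine Polynomial.funext fun z => ?_
    simpa [Polynomial.eval_finsetSum] using h z
  have := congrArg (fun p => Polynomial.coeff p (j : ℕ)) hp
  simpa [Polynomial.finsetSum_coeff, Polynomial.coeff_X_pow, ← Fin.ext_iff] using this

theorem coef2 (c : Fin 6 → Fin 6 → ℂ)
    (h : ∀ z ζ : ℂ, ∑ j, (∑ k, c j k * ζ ^ (k : ℕ)) * z ^ (j : ℕ) = 0) (j k : Fin 6) :
    c j k = 0 :=
  coef1 (c j) (fun ζ => coef1 (fun j => ∑ k, c j k * ζ ^ (k : ℕ)) (fun z => h z ζ) j) k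

theorem extract1 (c11 c12 c13 c14 a ab b a0 a1 a2 a3 b0 b1 b2 b3 k kb : ℂ)
    (h : ∀ z ζ : ℂ, z * b0 + ζ * a0 + (c11 * (z * ζ) + c12 * (z ^ 2 * ζ + z * ζ ^ 2)
        + c13 * (-Complex.I * (z ^ 2 * ζ - z * ζ ^ 2))
        + c14 * (a * z ^ 3 * ζ + ab * z * ζ ^ 3 + b * z ^ 2 * ζ ^ 2))
      + Complex.I * kb * z ^ 2 * ζ - Complex.I * k * z * ζ ^ 2
      = ζ * (a0 + a1 * z + a2 * z ^ 2 + a3 * z ^ 3 + Complex.I * z * ζ * k)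
        + z * (b0 + b1 * ζ + b2 * ζ ^ 2 + b3 * ζ ^ 3 - Complex.I * z * ζ * kb)) :
    c11 = a1 + b1 ∧ a2 = c12 - Complex.I * c13 + 2 * Complex.I * kb ∧ a3 = a * c14 := by
  have key := coef2 (![![0, a0 + (-(1)) * (a0), 0, 0, 0, 0],
      ![b0 + (-(1)) * (b0), c11 + (-(1)) * (a1) + (-(1)) * (b1), (-Complex.I) * k + c12 + Complex.I * c13 + (-(1)) * (Complex.I * k) + (-(1)) * (b2), ab * c14 + (-(1)) * (b3), 0, 0],
      ![0, Complex.I * kb + c12 + (-Complex.I) * c13 + (-(1)) * (a2) + (-(1)) * ((-Complex.I) * kb), b * c14, 0, 0, 0],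
      ![0, a * c14 + (-(1)) * (a3), 0, 0, 0, 0],
      ![0, 0, 0, 0, 0, 0],
      ![0, 0, 0, 0, 0, 0]]) (by
    intro z ζ
    simp [Fin.sum_univ_succ]
    linear_combination h z ζ)
  have e0 := key 1 1
  have e1 := key 2 1
  have e2 := key 3 1
  simp at e0 e1 e2
  refine ⟨?_, ?_, ?_⟩
  · linear_combination e0
  · linear_combination -e1
  · linear_combination -e2

theorem extract2 (c21 c22 c23 c24 a ab b a0 a1 a2 a3 b0 b1 b2 b3 k kb : ℂ)
    (h : ∀ z ζ : ℂ, z ^ 2 * b0 + ζ ^ 2 * a0 + (c21 * (z * ζ) + c22 * (z ^ 2 * ζ + z * ζ ^ 2)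
        + c23 * (-Complex.I * (z ^ 2 * ζ - z * ζ ^ 2))
        + c24 * (a * z ^ 3 * ζ + ab * z * ζ ^ 3 + b * z ^ 2 * ζ ^ 2))
      + Complex.I * kb * z ^ 3 * ζ - Complex.I * k * z * ζ ^ 3
      = (2 * z * ζ + ζ ^ 2) * (a0 + a1 * z + a2 * z ^ 2 + a3 * z ^ 3 + Complex.I * z * ζ * k)
        + (2 * z * ζ + z ^ 2) * (b0 + b1 * ζ + b2 * ζ ^ 2 + b3 * ζ ^ 3 - Complex.I * z * ζ * kb)) :
    c21 = 2 * a0 + 2 * b0 ∧ c22 - Complex.I * c23 = 2 * a1 + b1 ∧ a * c24 = 2 * a2 - 2 * Complex.I * kb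
      ∧ b * c24 = 2 * Complex.I * k + a2 + (-2 * Complex.I * kb + b2) ∧ a3 = 0 := by
  have key := coef2 (![![0, 0, a0 + (-(1)) * (a0), 0, 0, 0],
      ![0, c21 + (-(2)) * (a0) + (-(2)) * (b0), c22 + Complex.I * c23 + (-(1)) * (a1) + (-(2)) * (b1), (-Complex.I) * k + ab * c24 + (-(1)) * (Complex.I * k) + (-(2)) * (b2), (-(2)) * (b3), 0],
      ![b0 + (-(1)) * (b0), c22 + (-Complex.I) * c23 + (-(2)) * (a1) + (-(1)) * (b1), b * c24 + (-(2)) * (Complex.I * k) + (-(1)) * (a2) + (-(2)) * ((-Complex.I) * kb) + (-(1)) * (b2), (-(1)) * (b3), 0, 0],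
      ![0, Complex.I * kb + a * c24 + (-(2)) * (a2) + (-(1)) * ((-Complex.I) * kb), (-(1)) * (a3), 0, 0, 0],
      ![0, (-(2)) * (a3), 0, 0, 0, 0],
      ![0, 0, 0, 0, 0, 0]]) (by
    intro z ζ
    simp [Fin.sum_univ_succ]
    linear_combination h z ζ)
  have e0 := key 1 1
  have e1 := key 2 1
  have e2 := key 3 1
  have e3 := key 2 2
  have e4 := key 4 1
  simp at e0 e1 e2 e3 e4
  refine ⟨?_, ?_, ?_, ?_, ?_⟩
  · linear_combination e0
  · linear_combination e1
  · linear_combination e2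
  · linear_combination e3
  · exact e4

theorem extract3 (c31 c32 c33 c34 a ab b a0 a1 a2 a3 b0 b1 b2 b3 k kb : ℂ)
    (h : ∀ z ζ : ℂ, -Complex.I * z ^ 2 * b0 + Complex.I * ζ ^ 2 * a0 + (c31 * (z * ζ) + c32 * (z ^ 2 * ζ + z * ζ ^ 2)
        + c33 * (-Complex.I * (z ^ 2 * ζ - z * ζ ^ 2))
        + c34 * (a * z ^ 3 * ζ + ab * z * ζ ^ 3 + b * z ^ 2 * ζ ^ 2))
      + kb * z ^ 3 * ζ + k * z * ζ ^ 3
      = -Complex.I * (2 * z * ζ - ζ ^ 2) * (a0 + a1 * z + a2 * z ^ 2 + a3 * z ^ 3 + Complex.I * z * ζ * k)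
        + Complex.I * (2 * z * ζ - z ^ 2) * (b0 + b1 * ζ + b2 * ζ ^ 2 + b3 * ζ ^ 3 - Complex.I * z * ζ * kb)) :
    c31 = -2 * Complex.I * a0 + 2 * Complex.I * b0
      ∧ c32 - Complex.I * c33 = -2 * Complex.I * a1 - Complex.I * b1
      ∧ a * c34 = -2 * kb - 2 * Complex.I * a2
      ∧ b * c34 = 2 * k + Complex.I * a2 + 2 * kb - Complex.I * b2 := by
  have key := coef2 (![![0, 0, Complex.I * a0 + (-(Complex.I)) * (a0), 0, 0, 0],
      ![0, c31 + (-(-Complex.I * 2)) * (a0) + (-(Complex.I * 2)) * (b0), c32 + Complex.I * c33 + (-(Complex.I)) * (a1) + (-(Complex.I * 2)) * (b1), k + ab * c34 + (-(Complex.I)) * (Complex.I * k) + (-(Complex.I * 2)) * (b2), (-(Complex.I * 2)) * (b3), 0],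
      ![-Complex.I * b0 + (-(-Complex.I)) * (b0), c32 + (-Complex.I) * c33 + (-(-Complex.I * 2)) * (a1) + (-(-Complex.I)) * (b1), b * c34 + (-(-Complex.I * 2)) * (Complex.I * k) + (-(Complex.I)) * (a2) + (-(Complex.I * 2)) * ((-Complex.I) * kb) + (-(-Complex.I)) * (b2), (-(-Complex.I)) * (b3), 0, 0],
      ![0, kb + a * c34 + (-(-Complex.I * 2)) * (a2) + (-(-Complex.I)) * ((-Complex.I) * kb), (-(Complex.I)) * (a3), 0, 0, 0],
      ![0, (-(-Complex.I * 2)) * (a3), 0, 0, 0, 0],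
      ![0, 0, 0, 0, 0, 0]]) (by
    intro z ζ
    simp [Fin.sum_univ_succ]
    linear_combination h z ζ)
  have e0 := key 1 1
  have e1 := key 2 1
  have e2 := key 3 1
  have e3 := key 2 2
  simp at e0 e1 e2 e3
  refine ⟨?_, ?_, ?_, ?_⟩
  · linear_combination e0
  · linear_combination e1
  · linear_combination e2 + kb * Complex.I_sq
  · linear_combination e3 - 2 * (k + kb) * Complex.I_sq

theorem extract4 (c41 c42 c43 c44 a ab b a0 a1 a2 a3 b0 b1 b2 b3 : ℂ)
    (h : ∀ z ζ : ℂ, a * z ^ 3 * b0 + ab * ζ ^ 3 * a0 + (c41 * (z * ζ) + c42 * (z ^ 2 * ζ + z * ζ ^ 2)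
        + c43 * (-Complex.I * (z ^ 2 * ζ - z * ζ ^ 2))
        + c44 * (a * z ^ 3 * ζ + ab * z * ζ ^ 3 + b * z ^ 2 * ζ ^ 2))
      = (3 * a * z ^ 2 * ζ + ab * ζ ^ 3 + 2 * b * z * ζ ^ 2) * (a0 + a1 * z + a2 * z ^ 2 + a3 * z ^ 3)
        + (3 * ab * ζ ^ 2 * z + a * z ^ 3 + 2 * b * ζ * z ^ 2) * (b0 + b1 * ζ + b2 * ζ ^ 2 + b3 * ζ ^ 3)) :
    c41 = 0 ∧ c42 - Complex.I * c43 = 3 * a * a0 + 2 * b * b0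
      ∧ a * c44 = 3 * a * a1 + a * b1 := by
  have key := coef2 (![![0, 0, 0, ab * a0 + (-(ab)) * (a0), 0, 0],
      ![0, c41, c42 + Complex.I * c43 + (-(2 * b)) * (a0) + (-(3 * ab)) * (b0), ab * c44 + (-(ab)) * (a1) + (-(3 * ab)) * (b1), (-(3 * ab)) * (b2), (-(3 * ab)) * (b3)],
      ![0, c42 + (-Complex.I) * c43 + (-(3 * a)) * (a0) + (-(2 * b)) * (b0), b * c44 + (-(2 * b)) * (a1) + (-(2 * b)) * (b1), (-(ab)) * (a2) + (-(2 * b)) * (b2), (-(2 * b)) * (b3), 0],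
      ![a * b0 + (-(a)) * (b0), a * c44 + (-(3 * a)) * (a1) + (-(a)) * (b1), (-(2 * b)) * (a2) + (-(a)) * (b2), (-(ab)) * (a3) + (-(a)) * (b3), 0, 0],
      ![0, (-(3 * a)) * (a2), (-(2 * b)) * (a3), 0, 0, 0],
      ![0, (-(3 * a)) * (a3), 0, 0, 0, 0]]) (by
    intro z ζ
    simp [Fin.sum_univ_succ]
    linear_combination h z ζ)
  have e0 := key 1 1
  have e1 := key 2 1
  have e2 := key 3 1
  simp at e0 e1 e2
  refine ⟨?_, ?_, ?_⟩
  · linear_combination e0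
  · linear_combination e1
  · linear_combination e2

/-! ### Part 5 : the core computation -/

@[simp] theorem conj_two_C : conj (2 : ℂ) = 2 := map_ofNat _ 2

@[simp] theorem conj_three_C : conj (3 : ℂ) = 3 := map_ofNat _ 3

theorem conj_conj_diff {f : ℂ → ℂ} (hf : Differentiable ℂ f) :
    Differentiable ℂ (fun ζ => conj (f (conj ζ))) := by
  intro x
  have := (hf (conj x)).conj_conj
  rw [Complex.conj_conj] at this
  exact this

theorem im_re_conj {A B : ℂ} (h : A.im = 2 * B.re) :
    A - conj A = 2 * Complex.I * (B + conj B) := by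
  rw [Complex.sub_conj, Complex.add_conj, h]
  push_cast
  ring

/-- The combination `∑ cⱼ φⱼ(z, ζ)`. -/
def Sphi (a : ℂ) (b : ℝ) (c : Fin 4 → ℝ) (z ζ : ℂ) : ℂ :=
  c 0 * (z * ζ) + c 1 * (z ^ 2 * ζ + z * ζ ^ 2)
        + c 2 * (-Complex.I * (z ^ 2 * ζ - z * ζ ^ 2))
        + c 3 * (a * z ^ 3 * ζ + conj a * z * ζ ^ 3 + b * z ^ 2 * ζ ^ 2)

theorem Sphi_conj (a : ℂ) (b : ℝ) (c : Fin 4 → ℝ) (z : ℂ) :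
    conj (Sphi a b c z (conj z)) = Sphi a b c z (conj z) := by
  simp only [Sphi, map_add, map_mul, map_sub, map_neg, map_pow, Complex.conj_ofReal,
    Complex.conj_conj, Complex.conj_I]
  ring

theorem complexified (a : ℂ) (b : ℝ) (c : Fin 4 → ℝ) (f G : ℂ → ℂ) (E e D Db : ℂ → ℂ → ℂ)
    (κ : ℂ)
    (hf : Differentiable ℂ f) (hG : Differentiable ℂ G)
    (hE : Differentiable ℂ (fun q : ℂ × ℂ => E q.1 q.2))
    (he : Differentiable ℂ (fun q : ℂ × ℂ => e q.1 q.2))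
    (hD : Differentiable ℂ (fun q : ℂ × ℂ => D q.1 q.2))
    (hDb : Differentiable ℂ (fun q : ℂ × ℂ => Db q.1 q.2))
    (hEe : ∀ z, conj (E z (conj z)) = e z (conj z))
    (hDD : ∀ z, conj (D z (conj z)) = Db z (conj z))
    (h : ∀ z, (G z + E z (conj z) + Complex.I * Sphi a b c z (conj z)).im
      = 2 * (D z (conj z) * (f z + Complex.I * z * conj z * κ)).re) (z ζ : ℂ) :
    G z - conj (G (conj ζ)) + (E z ζ - e z ζ) + 2 * Complex.I * Sphi a b c z ζ
      = 2 * Complex.I * (D z ζ * (f z + Complex.I * z * ζ * κ)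
        + Db z ζ * (conj (f (conj ζ)) - Complex.I * z * ζ * conj κ)) := by
  have hfb : Differentiable ℂ (fun ζ => conj (f (conj ζ))) := conj_conj_diff hf
  have hGb : Differentiable ℂ (fun ζ => conj (G (conj ζ))) := conj_conj_diff hG
  rw [← sub_eq_zero]
  refine complexify (fun z ζ => G z - conj (G (conj ζ)) + (E z ζ - e z ζ)
      + 2 * Complex.I * Sphi a b c z ζ
      - 2 * Complex.I * (D z ζ * (f z + Complex.I * z * ζ * κ)
        + Db z ζ * (conj (f (conj ζ)) - Complex.I * z * ζ * conj κ))) ?_ ?_ z ζ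
  · have h1 := hf.comp (differentiable_fst (𝕜 := ℂ) (E := ℂ) (F := ℂ))
    have h2 := hG.comp (differentiable_fst (𝕜 := ℂ) (E := ℂ) (F := ℂ))
    have h3 := hfb.comp (differentiable_snd (𝕜 := ℂ) (E := ℂ) (F := ℂ))
    have h4 := hGb.comp (differentiable_snd (𝕜 := ℂ) (E := ℂ) (F := ℂ))
    simp only [Function.comp_def] at h1 h2 h3 h4
    unfold Sphi
    fun_prop
  · intro z
    have := im_re_conj (h z)
    simp only [map_add, map_mul, Sphi_conj, hEe, hDD, Complex.conj_I, Complex.conj_conj] at this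
    simp only [Complex.conj_conj]
    linear_combination this

theorem core (a : ℂ) (b : ℝ) (ha : a ≠ 0) (c : Fin 4 → Fin 4 → ℝ) (κ : ℂ)
    (f G1 G2 G3 G4 : ℂ → ℂ)
    (hf : Differentiable ℂ f) (hG1 : Differentiable ℂ G1) (hG2 : Differentiable ℂ G2)
    (hG3 : Differentiable ℂ G3) (hG4 : Differentiable ℂ G4)
    (h1 : ∀ z, (G1 z + -2 * conj κ * z ^ 2 * conj z
        + Complex.I * Sphi a b (c 0) z (conj z)).im
      = 2 * (conj z * (f z + Complex.I * z * conj z * κ)).re)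
    (h2 : ∀ z, (G2 z + (-2 * conj κ * z ^ 3 * conj z - 2 * κ.re * z ^ 2 * conj z ^ 2)
        + Complex.I * Sphi a b (c 1) z (conj z)).im
      = 2 * ((2 * z * conj z + conj z ^ 2) * (f z + Complex.I * z * conj z * κ)).re)
    (h3 : ∀ z, (G3 z + (2 * Complex.I * conj κ * z ^ 3 * conj z - 2 * κ.im * z ^ 2 * conj z ^ 2)
        + Complex.I * Sphi a b (c 2) z (conj z)).im
      = 2 * (-Complex.I * (2 * z * conj z - conj z ^ 2) * (f z + Complex.I * z * conj z * κ)).re)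
    (h4 : κ = 0 → ∀ z, (G4 z + 0 + Complex.I * Sphi a b (c 3) z (conj z)).im
      = 2 * ((3 * a * z ^ 2 * conj z + conj a * conj z ^ 3 + 2 * b * z * conj z ^ 2)
        * (f z + Complex.I * z * conj z * 0)).re) :
    κ = 0 ∧ ∃ (f0 : ℂ) (f1 g1 g2 g3 g4 : ℝ),
      (∀ z, f z = f0 + f1 * z) ∧
      (∀ z, G1 z = g1 + 2 * Complex.I * conj f0 * z) ∧
      (∀ z, G2 z = g2 + 2 * Complex.I * conj f0 * z ^ 2) ∧
      (∀ z, G3 z = g3 + 2 * conj f0 * z ^ 2) ∧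
      (∀ z, G4 z = g4 + 2 * Complex.I * a * conj f0 * z ^ 3) ∧
      c 0 = ![2 * f1, 0, 0, 0] ∧
      c 1 = ![4 * f0.re, 3 * f1, 0, 0] ∧
      c 2 = ![4 * f0.im, 0, 3 * f1, 0] ∧
      c 3 = ![0, (3 * a * f0 + 2 * b * conj f0).re, -(3 * a * f0 + 2 * b * conj f0).im,
        4 * f1] := by
  have H1 := complexified a b (c 0) f G1 (fun z ζ => -2 * conj κ * z ^ 2 * ζ)
    (fun z ζ => -2 * κ * z * ζ ^ 2) (fun z ζ => ζ) (fun z ζ => z) κ hf hG1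
    (by fun_prop) (by fun_prop) (by fun_prop) (by fun_prop)
    (by intro z; simp; ring) (by intro z; simp) h1
  have H2 := complexified a b (c 1) f G2
    (fun z ζ => -2 * conj κ * z ^ 3 * ζ - 2 * κ.re * z ^ 2 * ζ ^ 2)
    (fun z ζ => -2 * κ * z * ζ ^ 3 - 2 * κ.re * z ^ 2 * ζ ^ 2)
    (fun z ζ => 2 * z * ζ + ζ ^ 2) (fun z ζ => 2 * z * ζ + z ^ 2) κ hf hG2
    (by fun_prop) (by fun_prop) (by fun_prop) (by fun_prop)
    (by intro z; simp; ring) (by intro z; simp; ring) h2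
  have H3 := complexified a b (c 2) f G3
    (fun z ζ => 2 * Complex.I * conj κ * z ^ 3 * ζ - 2 * κ.im * z ^ 2 * ζ ^ 2)
    (fun z ζ => -2 * Complex.I * κ * z * ζ ^ 3 - 2 * κ.im * z ^ 2 * ζ ^ 2)
    (fun z ζ => -Complex.I * (2 * z * ζ - ζ ^ 2)) (fun z ζ => Complex.I * (2 * z * ζ - z ^ 2))
    κ hf hG3
    (by fun_prop) (by fun_prop) (by fun_prop) (by fun_prop)
    (by intro z; simp; ring) (by intro z; simp; ring) h3
  have H4 := fun hκ : κ = 0 => complexified a b (c 3) f G4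
    (fun z ζ => 0) (fun z ζ => 0)
    (fun z ζ => 3 * a * z ^ 2 * ζ + conj a * ζ ^ 3 + 2 * b * z * ζ ^ 2)
    (fun z ζ => 3 * conj a * ζ ^ 2 * z + a * z ^ 3 + 2 * b * ζ * z ^ 2)
    0 hf hG4
    (by fun_prop) (by fun_prop) (by fun_prop) (by fun_prop)
    (by intro z; simp) (by intro z; simp; try ring) (h4 hκ)
  clear h1 h2 h3 h4
  have hI := Complex.I_ne_zero
  have h2I : (2 * Complex.I) ≠ 0 := by simp
  -- the functions `G` and `f` are explicit
  have F0 : ∃ a0 a1 a2 a3 : ℂ, ∀ z, f z = a0 + a1 * z + a2 * z ^ 2 + a3 * z ^ 3 := by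
    refine ⟨(conj (G1 0) - conj (G1 1)) / (2 * Complex.I),
      conj (f 0) + c 0 0 + c 0 1 + Complex.I * c 0 2 + c 0 3 * conj a - 2 * Complex.I * κ
        - conj (f 1),
      c 0 1 - Complex.I * c 0 2 + b * c 0 3 + 2 * Complex.I * conj κ, a * c 0 3, ?_⟩
    intro z
    have e1 := H1 z 1
    have e0 := H1 z 0
    simp only [Sphi, map_one, map_zero] at e1 e0
    field_simp
    linear_combination -e1 + e0 + (2 * κ * z - 2 * z ^ 2 * conj κ) * Complex.I_sq
  obtain ⟨a0, a1, a2, a3, hF⟩ := F0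
  have hF0 : f 0 = a0 := by simp [hF]
  have hFb : ∀ ζ, conj (f (conj ζ))
      = conj a0 + conj a1 * ζ + conj a2 * ζ ^ 2 + conj a3 * ζ ^ 3 := by
    intro ζ; simp [hF]
  have R1 : conj (G1 0) = G1 0 := by
    have := H1 0 0; simp [Sphi] at this; linear_combination -this
  have R2 : conj (G2 0) = G2 0 := by
    have := H2 0 0; simp [Sphi] at this; linear_combination -this
  have R3 : conj (G3 0) = G3 0 := by
    have := H3 0 0; simp [Sphi] at this; linear_combination -this
  have K1 : ∀ z, G1 z = G1 0 + 2 * Complex.I * conj a0 * z := by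
    intro z
    have := H1 z 0
    simp [Sphi, hF0] at this
    linear_combination this + R1
  have K2 : ∀ z, G2 z = G2 0 + 2 * Complex.I * conj a0 * z ^ 2 := by
    intro z
    have := H2 z 0
    simp [Sphi, hF0] at this
    linear_combination this + R2
  have K3 : ∀ z, G3 z = G3 0 + 2 * conj a0 * z ^ 2 := by
    intro z
    have := H3 z 0
    simp [Sphi, hF0] at this
    linear_combination this + R3 - 2 * z ^ 2 * conj a0 * Complex.I_sq
  have K1b : ∀ ζ, conj (G1 (conj ζ)) = G1 0 - 2 * Complex.I * a0 * ζ := by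
    intro ζ; rw [K1]; simp [R1]; ring
  have K2b : ∀ ζ, conj (G2 (conj ζ)) = G2 0 - 2 * Complex.I * a0 * ζ ^ 2 := by
    intro ζ; rw [K2]; simp [R2]; ring
  have K3b : ∀ ζ, conj (G3 (conj ζ)) = G3 0 + 2 * a0 * ζ ^ 2 := by
    intro ζ; rw [K3]; simp [R3]
  obtain ⟨p11, p12, p13⟩ := extract1 (c 0 0) (c 0 1) (c 0 2) (c 0 3) a (conj a) b a0 a1 a2 a3
    (conj a0) (conj a1) (conj a2) (conj a3) κ (conj κ) (by
      intro z ζ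
      have := H1 z ζ
      rw [hF, hFb, K1, K1b] at this
      simp only [Sphi] at this
      apply mul_left_cancel₀ h2I
      linear_combination this + (2 * conj κ * z ^ 2 * ζ - 2 * κ * z * ζ ^ 2) * Complex.I_sq)
  obtain ⟨p21, p22, p23, p24, p25⟩ := extract2 (c 1 0) (c 1 1) (c 1 2) (c 1 3) a (conj a) b
    a0 a1 a2 a3 (conj a0) (conj a1) (conj a2) (conj a3) κ (conj κ) (by
      intro z ζ
      have := H2 z ζ
      rw [hF, hFb, K2, K2b] at this
      simp only [Sphi] at this
      apply mul_left_cancel₀ h2I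
      linear_combination this + (2 * conj κ * z ^ 3 * ζ - 2 * κ * z * ζ ^ 3) * Complex.I_sq)
  obtain ⟨p31, p32, p33, p34⟩ := extract3 (c 2 0) (c 2 1) (c 2 2) (c 2 3) a (conj a) b
    a0 a1 a2 a3 (conj a0) (conj a1) (conj a2) (conj a3) κ (conj κ) (by
      intro z ζ
      have := H3 z ζ
      rw [hF, hFb, K3, K3b] at this
      simp only [Sphi] at this
      apply mul_left_cancel₀ h2I
      linear_combination this + (-2 * conj a0 * z ^ 2 + 2 * a0 * ζ ^ 2) * Complex.I_sq)
  have q24 : (c 2 3 : ℂ) = -Complex.I * c 1 3 := by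
    apply mul_left_cancel₀ ha
    linear_combination p33 + Complex.I * p23 - 2 * conj κ * Complex.I_sq
  have c23 : c 2 3 = 0 := by simpa using congrArg Complex.re q24
  have c13 : c 1 3 = 0 := by simpa using (congrArg Complex.im q24).symm
  have a2e : a2 = Complex.I * conj κ := by
    rw [c13] at p23
    push_cast at p23
    linear_combination -p23 / 2
  have b2e : conj a2 = -Complex.I * κ := by rw [a2e]; simp
  rw [c13, b2e] at p24
  rw [c23, b2e] at p34
  have hκ : κ = 0 := by
    rw [a2e] at p24 p34
    push_cast at p24 p34
    have e1 : κ - conj κ = 0 := by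
      apply mul_left_cancel₀ hI
      linear_combination -p24
    have e2 : κ + conj κ = 0 := by
      linear_combination -p34 + (-conj κ - κ) * Complex.I_sq
    linear_combination (e1 + e2) / 2
  have a20 : a2 = 0 := by rw [a2e, hκ]; simp
  have a30 : a3 = 0 := p25
  have c03 : c 0 3 = 0 := by
    rw [a30] at p13
    simpa [ha] using p13.symm
  rw [a20, hκ] at p12
  have c01 : c 0 1 = 0 := by simpa using (congrArg Complex.re p12).symm
  have c02 : c 0 2 = 0 := by simpa using (congrArg Complex.im p12).symm
  have H4' := H4 hκ
  have R4 : conj (G4 0) = G4 0 := by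
    have := H4' 0 0; simp [Sphi] at this; linear_combination -this
  have K4 : ∀ z, G4 z = G4 0 + 2 * Complex.I * a * conj a0 * z ^ 3 := by
    intro z
    have := H4' z 0
    simp [Sphi, hF0] at this
    linear_combination this + R4
  have K4b : ∀ ζ, conj (G4 (conj ζ)) = G4 0 - 2 * Complex.I * conj a * a0 * ζ ^ 3 := by
    intro ζ; rw [K4]; simp [R4]; ring
  obtain ⟨p41, p42, p43⟩ := extract4 (c 3 0) (c 3 1) (c 3 2) (c 3 3) a (conj a) b
    a0 a1 a2 a3 (conj a0) (conj a1) (conj a2) (conj a3) (by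
      intro z ζ
      have := H4' z ζ
      rw [hF, hFb, K4, K4b] at this
      simp only [Sphi, map_zero] at this
      apply mul_left_cancel₀ h2I
      linear_combination this)
  have p44 : (c 3 3 : ℂ) = 3 * a1 + conj a1 := by
    apply mul_left_cancel₀ ha
    linear_combination p43
  have a1i : a1.im = 0 := by
    have := congrArg Complex.im p44
    simp at this
    linarith
  have a1c : conj a1 = a1 := Complex.conj_eq_iff_im.mpr a1i
  have a1r : a1 = (a1.re : ℂ) := (Complex.conj_eq_iff_re.mp a1c).symm
  refine ⟨hκ, a0, a1.re, (G1 0).re, (G2 0).re, (G3 0).re, (G4 0).re, ?_, ?_, ?_, ?_, ?_, ?_, ?_,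
    ?_, ?_⟩
  · intro z; rw [hF, a20, a30, ← a1r]; ring
  · rwa [Complex.conj_eq_iff_re.mp R1]
  · rwa [Complex.conj_eq_iff_re.mp R2]
  · rwa [Complex.conj_eq_iff_re.mp R3]
  · rwa [Complex.conj_eq_iff_re.mp R4]
  · have t := congrArg Complex.re p11
    simp at t
    ext j; fin_cases j
    · simp; linarith
    · simpa using c01
    · simpa using c02
    · simpa using c03
  · have t := congrArg Complex.re p21
    have t1 := congrArg Complex.re p22
    have t2 := congrArg Complex.im p22
    simp [a1i] at t t1 t2
    ext j; fin_cases j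
    · simp; linarith
    · simp; linarith
    · simpa using t2
    · simpa using c13
  · have t := congrArg Complex.re p31
    have t1 := congrArg Complex.re p32
    have t2 := congrArg Complex.im p32
    simp [a1i] at t t1 t2
    ext j; fin_cases j
    · simp; linarith
    · simpa using t1
    · simp; linarith
    · simpa using c23
  · have t1 := congrArg Complex.re p42
    have t2 := congrArg Complex.im p42
    have t3 := congrArg Complex.re p44
    ext j; fin_cases j
    · simpa using p41
    · simpa using t1
    · simp at t2 ⊢; linarith
    · simp at t3 ⊢; linarith

/-! ### Part 6 : the seven-dimensional family and the induction -/

section Family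

open MvPolynomial

/-- The seven-parameter family of infinitesimal automorphisms, as polynomials. -/
def SP (a : ℂ) (b : ℝ) (f0 : ℂ) (f1 : ℝ) (k : Fin 4 → ℝ) : Fin 5 → MvPolynomial (Fin 5) ℂ :=
  ![C f0 + C (f1 : ℂ) * X 0,
    C (2 * Complex.I * conj f0) * X 0 + C (2 * f1 : ℂ) * X 1 + C (k 0 : ℂ),
    C (2 * Complex.I * conj f0) * X 0 ^ 2 + C (4 * f0.re : ℂ) * X 1 + C (3 * f1 : ℂ) * X 2
      + C (k 1 : ℂ),
    C (2 * conj f0) * X 0 ^ 2 + C (4 * f0.im : ℂ) * X 1 + C (3 * f1 : ℂ) * X 3 + C (k 2 : ℂ),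
    C (2 * Complex.I * a * conj f0) * X 0 ^ 3
      + C ((3 * a * f0 + 2 * b * conj f0).re : ℂ) * X 2
      - C ((3 * a * f0 + 2 * b * conj f0).im : ℂ) * X 3 + C (4 * f1 : ℂ) * X 4 + C (k 3 : ℂ)]

/-- The map `ℂ⁵ → ℂ⁵` defined by five polynomials. -/
def evalMap (Q : Fin 5 → MvPolynomial (Fin 5) ℂ) (p : C5) : C5 :=
  (eval ![p.1, p.2.1, p.2.2.1, p.2.2.2.1, p.2.2.2.2] (Q 0),
           eval ![p.1, p.2.1, p.2.2.1, p.2.2.2.1, p.2.2.2.2] (Q 1),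
           eval ![p.1, p.2.1, p.2.2.1, p.2.2.2.1, p.2.2.2.2] (Q 2),
           eval ![p.1, p.2.1, p.2.2.1, p.2.2.2.1, p.2.2.2.2] (Q 3),
           eval ![p.1, p.2.1, p.2.2.1, p.2.2.2.1, p.2.2.2.2] (Q 4))

/-- Tangency of a map to the model. -/
def Tan (a : ℂ) (b : ℝ) (F : C5 → C5) : Prop :=
  ∀ p ∈ BModel a b, ∀ k : Fin 4, fderiv ℝ (rho a b k) p (F p) = 0

theorem tan_iff (a : ℂ) (b : ℝ) (F : C5 → C5) : Tan a b F ↔ ∀ p ∈ BModel a b,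
    (F p).2.1.im = 2 * (conj p.1 * (F p).1).re ∧
    (F p).2.2.1.im = 2 * ((2 * p.1 * conj p.1 + conj p.1 ^ 2) * (F p).1).re ∧
    (F p).2.2.2.1.im
      = 2 * (-Complex.I * (2 * p.1 * conj p.1 - conj p.1 ^ 2) * (F p).1).re ∧
    (F p).2.2.2.2.im = 2 * ((3 * a * p.1 ^ 2 * conj p.1 + conj a * conj p.1 ^ 3
            + 2 * b * p.1 * conj p.1 ^ 2) * (F p).1).re := by
  unfold Tan
  refine forall₂_congr fun p _ => ?_
  constructor
  · intro h
    have h0 := h 0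
    have h1 := h 1
    have h2 := h 2
    have h3 := h 3
    rw [fd0] at h0
    rw [fd1] at h1
    rw [fd2] at h2
    rw [fd3] at h3
    exact ⟨sub_eq_zero.mp h0, sub_eq_zero.mp h1, sub_eq_zero.mp h2, sub_eq_zero.mp h3⟩
  · rintro ⟨h0, h1, h2, h3⟩ k
    fin_cases k
    · exact (fd0 a b p (F p)).trans (sub_eq_zero.mpr h0)
    · exact (fd1 a b p (F p)).trans (sub_eq_zero.mpr h1)
    · exact (fd2 a b p (F p)).trans (sub_eq_zero.mpr h2)
    · exact (fd3 a b p (F p)).trans (sub_eq_zero.mpr h3)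

theorem tan_SP (a : ℂ) (b : ℝ) (f0 : ℂ) (f1 : ℝ) (k : Fin 4 → ℝ) :
    Tan a b (evalMap (SP a b f0 f1 k)) := by
  rw [tan_iff]
  rintro ⟨z, w1, w2, w3, w4⟩ ⟨h1, h2, h3, h4⟩
  simp only at h1 h2 h3 h4
  simp [Complex.normSq_apply, pow_succ] at h1 h2 h3 h4
  refine ⟨?_, ?_, ?_, ?_⟩
  · simp [evalMap, SP, pow_succ, h1]
    ring
  · simp [evalMap, SP, pow_succ, h1, h2]
    ring
  · simp [evalMap, SP, pow_succ, h1, h3]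
    ring
  · simp [evalMap, SP, pow_succ, h2, h3, h4]
    ring

theorem pderiv_swap (i j : Fin 5) (P : MvPolynomial (Fin 5) ℂ) :
    pderiv i (pderiv j P) = pderiv j (pderiv i P) := by
  have : ⁅(pderiv i : Derivation ℂ (MvPolynomial (Fin 5) ℂ) (MvPolynomial (Fin 5) ℂ)),
      (pderiv j : Derivation ℂ (MvPolynomial (Fin 5) ℂ) (MvPolynomial (Fin 5) ℂ))⁆ = 0 := by
    apply MvPolynomial.derivation_ext
    intro n
    rw [Derivation.commutator_apply]
    simp only [pderiv_X, Pi.single_apply]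
    split_ifs <;> simp
  have h := congrArg (fun D => D P) this
  simp only [Derivation.commutator_apply] at h
  exact sub_eq_zero.mp h

theorem tan_pderiv (a : ℂ) (b : ℝ) (Q : Fin 5 → MvPolynomial (Fin 5) ℂ)
    (h : Tan a b (evalMap Q)) (j : Fin 4) :
    Tan a b (evalMap (fun l => pderiv j.succ (Q l))) := by
  rw [tan_iff] at h ⊢
  rintro ⟨z, w1, w2, w3, w4⟩ hp
  have hd := fun l => hasDerivAt_shift (Q l) ![z, w1, w2, w3, w4] j.succ
  -- the shifted points remain in the model
  have hs : ∀ s : ℝ, ∃ q ∈ BModel a b, q.1 = z ∧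
      ![q.1, q.2.1, q.2.2.1, q.2.2.2.1, q.2.2.2.2]
        = ![z, w1, w2, w3, w4] + (s : ℂ) • Pi.single j.succ 1 := by
    intro s
    set x := ![z, w1, w2, w3, w4] + (s : ℂ) • Pi.single j.succ (1 : ℂ) with hx
    have hx0 : x 0 = z := by
      have e : (Pi.single j.succ (1 : ℂ) : Fin 5 → ℂ) 0 = 0 :=
        Pi.single_eq_of_ne (Fin.succ_ne_zero j).symm _
      show z + (s : ℂ) * (Pi.single j.succ (1 : ℂ) : Fin 5 → ℂ) 0 = z
      rw [e, mul_zero, add_zero]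
    have him : ∀ i : Fin 4, (x i.succ).im = (![z, w1, w2, w3, w4] i.succ).im := by
      intro i
      have e : ((Pi.single j.succ (1 : ℂ) : Fin 5 → ℂ) i.succ).im = 0 := by
        rw [Pi.single_apply]
        split_ifs <;> simp
      show (![z, w1, w2, w3, w4] i.succ
        + (s : ℂ) * (Pi.single j.succ (1 : ℂ) : Fin 5 → ℂ) i.succ).im = _
      rw [Complex.add_im, Complex.im_ofReal_mul, e, mul_zero, add_zero]
    refine ⟨(x 0, x 1, x 2, x 3, x 4), ?_, hx0, ?_⟩
    · obtain ⟨h1, h2, h3, h4⟩ := hp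
      have e1 := him 0
      have e2 := him 1
      have e3 := him 2
      have e4 := him 3
      refine ⟨?_, ?_, ?_, ?_⟩
      · simp only [hx0]; exact e1.trans h1
      · simp only [hx0]; exact e2.trans h2
      · simp only [hx0]; exact e3.trans h3
      · simp only [hx0]; exact e4.trans h4
    · ext i; fin_cases i <;> rfl
  have hcl : ∀ (l : Fin 5) (D : ℂ),
      (∀ s : ℝ, (eval (![z, w1, w2, w3, w4] + (s : ℂ) • Pi.single j.succ 1) (Q l)).im
        = 2 * (D * eval (![z, w1, w2, w3, w4] + (s : ℂ) • Pi.single j.succ 1) (Q 0)).re) →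
      (eval ![z, w1, w2, w3, w4] (pderiv j.succ (Q l))).im
        = 2 * (D * eval ![z, w1, w2, w3, w4] (pderiv j.succ (Q 0))).re := by
    intro l D hall
    have d1 := Complex.imCLM.hasFDerivAt.comp_hasDerivAt (0 : ℝ) (hd l)
    have d2 := (Complex.reCLM.hasFDerivAt.comp_hasDerivAt (0 : ℝ)
      ((hd 0).const_mul D)).const_mul (2 : ℝ)
    exact d1.unique (d2.congr_of_eventuallyEq (Filter.Eventually.of_forall hall))
  refine ⟨hcl 1 _ ?_, hcl 2 _ ?_, hcl 3 _ ?_, hcl 4 _ ?_⟩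
  all_goals
    intro s
    obtain ⟨q, hq, hqz, hqx⟩ := hs s
    have := h q hq
    simp only [evalMap, hqx] at this
    simp only [hqz] at this
  · exact this.1
  · exact this.2.1
  · exact this.2.2.1
  · exact this.2.2.2

theorem eval_differentiable (P : MvPolynomial (Fin 5) ℂ) :
    Differentiable ℂ (fun z : ℂ => eval ![z, 0, 0, 0, 0] P) := by
  induction P using MvPolynomial.induction_on with
  | C c => simp
  | add p q hp hq => simp only [map_add]; exact hp.add hq
  | mul_X p n hp =>
    simp only [map_mul, eval_X]
    refine hp.mul ?_
    fin_cases n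
    · exact differentiable_id
    all_goals exact differentiable_const _

/-- The explicit part of a field whose `w`-derivatives lie in the family. -/
def EP (a κ : ℂ) (k : Fin 4 → Fin 4 → ℝ) : Fin 5 → MvPolynomial (Fin 5) ℂ :=
  ![C κ * X 1,
    C (2 * Complex.I * conj κ) * X 0 * X 1
      + (C (k 0 0 : ℂ) * X 1 + C (k 1 0 : ℂ) * X 2 + C (k 2 0 : ℂ) * X 3 + C (k 3 0 : ℂ) * X 4),
    C (2 * κ.re : ℂ) * X 1 ^ 2 + C (2 * Complex.I * conj κ) * X 0 ^ 2 * X 1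
      + (C (k 0 1 : ℂ) * X 1 + C (k 1 1 : ℂ) * X 2 + C (k 2 1 : ℂ) * X 3 + C (k 3 1 : ℂ) * X 4),
    C (2 * κ.im : ℂ) * X 1 ^ 2 + C (2 * conj κ) * X 0 ^ 2 * X 1
      + (C (k 0 2 : ℂ) * X 1 + C (k 1 2 : ℂ) * X 2 + C (k 2 2 : ℂ) * X 3 + C (k 3 2 : ℂ) * X 4),
    C (2 * Complex.I * a * conj κ) * X 0 ^ 3 * X 1
      + (C (k 0 3 : ℂ) * X 1 + C (k 1 3 : ℂ) * X 2 + C (k 2 3 : ℂ) * X 3 + C (k 3 3 : ℂ) * X 4)]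

theorem symm_consequences (a : ℂ) (b : ℝ) (f0 : Fin 4 → ℂ) (f1 : Fin 4 → ℝ)
    (k : Fin 4 → Fin 4 → ℝ)
    (h : ∀ (i j : Fin 4) (l : Fin 5), pderiv i.succ (SP a b (f0 j) (f1 j) (k j) l)
      = pderiv j.succ (SP a b (f0 i) (f1 i) (k i) l)) :
    (∀ j, f1 j = 0) ∧ f0 1 = 0 ∧ f0 2 = 0 ∧ f0 3 = 0 ∧
      (3 * a * f0 0 + 2 * b * conj (f0 0)).re = 0 ∧
      (3 * a * f0 0 + 2 * b * conj (f0 0)).im = 0 := by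
  have A1 := h 0 1 1
  have A2 := h 0 2 1
  have A3 := h 0 3 1
  have A4 := h 0 3 4
  have B1 := h 0 1 2
  have B2 := h 0 2 2
  have B3 := h 0 3 2
  have D1 := h 0 1 3
  have D2 := h 0 2 3
  have D3 := h 0 3 3
  have M1 := h 0 1 4
  have M2 := h 0 2 4
  clear h
  simp [SP, pderiv_X] at A1 A2 A3 A4 B1 B2 B3 D1 D2 D3 M1 M2
  have M1' := congrArg (fun P => (eval (fun _ => (0 : ℂ)) P).re) M1
  have M2' := congrArg (fun P => (eval (fun _ => (0 : ℂ)) P).re) M2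
  rw [A4] at B1 D2
  simp at B1 D2 M1' M2'
  refine ⟨?_, Complex.ext B1 D1, Complex.ext B2 D2, Complex.ext B3 D3, ?_, ?_⟩
  · intro j
    fin_cases j
    exacts [A4, A1, A2, A3]
  · simp
    linarith
  · simp
    linarith


theorem claim (a : ℂ) (b : ℝ) (ha : a ≠ 0) (Q : Fin 5 → MvPolynomial (Fin 5) ℂ)
    (hT : Tan a b (evalMap Q))
    (hQ : ∀ j : Fin 4, ∃ (f0 : ℂ) (f1 : ℝ) (k : Fin 4 → ℝ), ∀ l,
      pderiv j.succ (Q l) = SP a b f0 f1 k l) :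
    ∃ (f0 : ℂ) (f1 : ℝ) (k : Fin 4 → ℝ), ∀ l, Q l = SP a b f0 f1 k l := by
  choose f0 f1 k hk using hQ
  obtain ⟨hf1, h01, h02, h03, hm1, hm2⟩ := symm_consequences a b f0 f1 k (by
    intro i j l
    rw [← hk, ← hk, pderiv_swap])
  obtain ⟨κ, hκ⟩ : ∃ κ, κ = f0 0 := ⟨_, rfl⟩
  rw [← hκ] at hm1 hm2
  have h4 : (C 4 : MvPolynomial (Fin 5) ℂ) = C 2 * 2 := by
    rw [show (2 : MvPolynomial (Fin 5) ℂ) = C 2 from (map_ofNat C 2).symm, ← C_mul]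
    norm_num
  have hz : ∀ (l : Fin 5) (j : Fin 4), pderiv j.succ (Q l - EP a κ k l) = 0 := by
    intro l j
    rw [map_sub, hk, hf1]
    fin_cases j
    · show SP a b (f0 0) _ _ l - pderiv 1 _ = 0
      rw [← hκ]
      fin_cases l
      all_goals simp [SP, EP, pderiv_X, hm1, hm2, -map_mul, -map_add, -map_sub]
      all_goals simp
      all_goals try rw [h4]
      all_goals try ring
    · show SP a b (f0 1) _ _ l - pderiv 2 _ = 0
      rw [h01]
      fin_cases l <;> simp [SP, EP, pderiv_X]
    · show SP a b (f0 2) _ _ l - pderiv 3 _ = 0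
      rw [h02]
      fin_cases l <;> simp [SP, EP, pderiv_X]
    · show SP a b (f0 3) _ _ l - pderiv 4 _ = 0
      rw [h03]
      fin_cases l <;> simp [SP, EP, pderiv_X]
  have hev : ∀ (l : Fin 5) (z w1 w2 w3 w4 : ℂ), eval ![z, w1, w2, w3, w4] (Q l)
      = eval ![z, 0, 0, 0, 0] (Q l) + eval ![z, w1, w2, w3, w4] (EP a κ k l) := by
    intro l z w1 w2 w3 w4
    have h := eval_indep _ (hz l) z w1 w2 w3 w4
    rw [map_sub, map_sub] at h
    have h0 : eval ![z, 0, 0, 0, 0] (EP a κ k l) = 0 := by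
      fin_cases l <;> simp [EP]
    rw [h0] at h
    linear_combination h
  rw [tan_iff] at hT
  have hpt : ∀ z : ℂ, ((z, Complex.I * (z * conj z),
      Complex.I * (z ^ 2 * conj z + z * conj z ^ 2),
      Complex.I * (-Complex.I * (z ^ 2 * conj z - z * conj z ^ 2)),
      Complex.I * (a * z ^ 3 * conj z + conj a * z * conj z ^ 3 + b * z ^ 2 * conj z ^ 2)) : C5)
      ∈ BModel a b := by
    intro z
    refine ⟨?_, ?_, ?_, ?_⟩
    all_goals simp [Complex.normSq_apply, pow_succ]
    all_goals ring
  obtain ⟨hκ0, g0, g1, c1, c2, c3, c4, hf, hG1, hG2, hG3, hG4, e0, e1, e2, e3⟩ :=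
    core a b ha (fun l j => k j l) κ
      (fun z => eval ![z, 0, 0, 0, 0] (Q 0)) (fun z => eval ![z, 0, 0, 0, 0] (Q 1))
      (fun z => eval ![z, 0, 0, 0, 0] (Q 2)) (fun z => eval ![z, 0, 0, 0, 0] (Q 3))
      (fun z => eval ![z, 0, 0, 0, 0] (Q 4))
      (eval_differentiable _) (eval_differentiable _) (eval_differentiable _)
      (eval_differentiable _) (eval_differentiable _)
      (by
        intro z
        have h := (hT _ (hpt z)).1
        simp only [evalMap] at h
        rw [hev 0, hev 1] at h
        convert h using 2
        · simp [EP, Sphi]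
          linear_combination (-2 * conj κ * z ^ 2 * conj z) * Complex.I_sq
        · congr 1
          simp [EP]
          left
          ring)
      (by
        intro z
        have h := (hT _ (hpt z)).2.1
        simp only [evalMap] at h
        rw [hev 0, hev 2] at h
        convert h using 2
        · simp [EP, Sphi]
          linear_combination (-2 * conj κ * z ^ 3 * conj z
            - 2 * κ.re * z ^ 2 * conj z ^ 2) * Complex.I_sq
        · congr 1
          simp [EP]
          left
          ring)
      (by
        intro z
        have h := (hT _ (hpt z)).2.2.1
        simp only [evalMap] at h
        rw [hev 0, hev 3] at h
        convert h using 2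
        · simp [EP, Sphi]
          linear_combination (- 2 * κ.im * z ^ 2 * conj z ^ 2) * Complex.I_sq
        · congr 1
          simp [EP]
          left
          ring)
      (by
        intro h0 z
        have h := (hT _ (hpt z)).2.2.2
        simp only [evalMap] at h
        rw [hev 0, hev 4, h0] at h
        convert h using 2
        · simp [EP, Sphi]
          ring
        · congr 1
          simp [EP])
  refine ⟨g0, g1, ![c1, c2, c3, c4], fun l => MvPolynomial.funext fun x => ?_⟩
  have hx : x = ![x 0, x 1, x 2, x 3, x 4] := by
    ext i; fin_cases i <;> rfl
  rw [hx, hev, hκ0]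
  have E : ∀ j : Fin 4, k j 0 = (![2 * g1, 0, 0, 0] : Fin 4 → ℝ) j := fun j => congrFun e0 j
  have E1 : ∀ j : Fin 4, k j 1 = (![4 * g0.re, 3 * g1, 0, 0] : Fin 4 → ℝ) j :=
    fun j => congrFun e1 j
  have E2 : ∀ j : Fin 4, k j 2 = (![4 * g0.im, 0, 3 * g1, 0] : Fin 4 → ℝ) j :=
    fun j => congrFun e2 j
  have E3 : ∀ j : Fin 4, k j 3 = (![0, (3 * a * g0 + 2 * b * conj g0).re,
    -(3 * a * g0 + 2 * b * conj g0).im, 4 * g1] : Fin 4 → ℝ) j :=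
    fun j => congrFun e3 j
  have hf := hf (x 0)
  have hG1 := hG1 (x 0)
  have hG2 := hG2 (x 0)
  have hG3 := hG3 (x 0)
  have hG4 := hG4 (x 0)
  fin_cases l
  · show eval _ (Q 0) + _ = _
    rw [hf]
    simp [EP, SP]
  · show eval _ (Q 1) + _ = _
    rw [hG1]
    simp [EP, SP, E]
    ring
  · show eval _ (Q 2) + _ = _
    rw [hG2]
    simp [EP, SP, E1]
    ring
  · show eval _ (Q 3) + _ = _
    rw [hG3]
    simp [EP, SP, E2]
    ring
  · show eval _ (Q 4) + _ = _
    rw [hG4]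
    simp [EP, SP, E3]
    ring

theorem induct (a : ℂ) (b : ℝ) (ha : a ≠ 0) (n : ℕ) : ∀ (Q : Fin 5 → MvPolynomial (Fin 5) ℂ),
    (∀ l, (Q l).totalDegree ≤ n) → Tan a b (evalMap Q) →
    ∃ (f0 : ℂ) (f1 : ℝ) (k : Fin 4 → ℝ), ∀ l, Q l = SP a b f0 f1 k l := by
  induction n with
  | zero =>
    intro Q hd hT
    refine claim a b ha Q hT fun j => ⟨0, 0, 0, fun l => ?_⟩
    rw [totalDegree_eq_zero_iff_eq_C.mp (Nat.le_zero.mp (hd l)), pderiv_C]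
    fin_cases l <;> simp [SP]
  | succ n ih =>
    intro Q hd hT
    exact claim a b ha Q hT fun j =>
      ih _ (fun l => pderiv_degree (Q l) j.succ n (hd l)) (tan_pderiv a b Q hT j)

/-- The linear parametrisation of the family. -/
def famMap (a : ℂ) (b : ℝ) : (ℂ × ℝ × (Fin 4 → ℝ)) →ₗ[ℝ] (C5 → C5) where
  toFun s := evalMap (SP a b s.1 s.2.1 s.2.2)
  map_add' s t := by
    funext p
    simp only [evalMap, SP, Pi.add_apply, Prod.mk_add_mk, Prod.mk.injEq]
    refine ⟨?_, ?_, ?_, ?_, ?_⟩ <;> simp <;> ring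
  map_smul' r s := by
    funext p
    simp only [evalMap, SP, Pi.smul_apply, Prod.smul_mk, Prod.mk.injEq]
    refine ⟨?_, ?_, ?_, ?_, ?_⟩ <;> simp <;> ring

theorem famMap_injective (a : ℂ) (b : ℝ) : Function.Injective (famMap a b) := by
  rw [← LinearMap.ker_eq_bot, LinearMap.ker_eq_bot']
  rintro ⟨f0, f1, k⟩ h
  have h0 := congrFun h 0
  have h1 := congrFun h (1, 0)
  simp [famMap, evalMap, SP, Prod.ext_iff] at h0 h1
  obtain ⟨h00, h01, h02, h03, h04⟩ := h0
  have h10 := h1.1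
  rw [h00] at h10
  simp at h10
  refine Prod.ext h00 (Prod.ext h10 ?_)
  funext i
  fin_cases i
  exacts [h01, h02, h03, h04]

end Family

/-- for `a ≠ 0`, the set of polynomial holomorphic vector fields `X` on `ℂ⁵`
whose real part is tangent to `M(a,b)` — i.e. `Dρₖ(p)[X(p)] = 0` for all `p ∈ M(a,b)` and
all `k` — is a real vector subspace of dimension `7`: the Lie algebra of infinitesimal
CR-automorphisms of `M(a,b)`. -/
theorem autCR_dimension_seven (a : ℂ) (b : ℝ) (ha : a ≠ 0) :
    ∃ V : Submodule ℝ (C5 → C5),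
      (V : Set (C5 → C5)) =
        {F : C5 → C5 | IsPolyMap F ∧
          ∀ p ∈ BModel a b, ∀ k : Fin 4, fderiv ℝ (rho a b k) p (F p) = 0} ∧
      Module.finrank ℝ V = 7 := by
  refine ⟨LinearMap.range (famMap a b), ?_, ?_⟩
  · ext F
    simp only [SetLike.mem_coe, LinearMap.mem_range, Set.mem_ofPred_eq]
    constructor
    · rintro ⟨s, rfl⟩
      exact ⟨⟨SP a b s.1 s.2.1 s.2.2, fun p => rfl⟩, tan_SP a b s.1 s.2.1 s.2.2⟩
    · rintro ⟨⟨Q, hQ⟩, hT⟩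
      have hF : F = evalMap Q := funext hQ
      subst hF
      obtain ⟨f0, f1, k, h⟩ := induct a b ha (Finset.univ.sup fun l => (Q l).totalDegree) Q
        (fun l => Finset.le_sup (f := fun l => (Q l).totalDegree) (Finset.mem_univ l)) hT
      refine ⟨(f0, f1, k), ?_⟩
      show evalMap (SP a b f0 f1 k) = evalMap Q
      rw [funext h]
  · rw [LinearMap.finrank_range_of_inj (famMap_injective a b)]
    simp
end
end
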